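/- Let Φ be a Young function satisfying the Δ2-condition. Every sequentially τ(L_{Φ*},L_Φ)-closed convex subset of L_{Φ*} is σ(L_{Φ*},L_Φ)-closed. -/

import Mathlib

open MeasureTheory Filter Topology Set
open scoped ENNReal

noncomputable section

namespace OrliczPaper

variable {Ω : Type*} [MeasurableSpace Ω]

/-- A (finite, coercive) Young function: an even convex function with `Φ 0 = 0`
and `Φ x / x → ∞` as `x → ∞`. -/
structure IsYoung (Φ : ℝ → ℝ) : Prop where
  even : ∀ x, Φ (-x) = Φ x
  convexOn : ConvexOn ℝ Set.univ Φ
  map_zero : Φ 0 = 0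
  coercive : Tendsto (fun x => Φ x / x) atTop atTop

/-- The Δ₂-condition: `limsup_{x→∞} Φ(2x)/Φ(x) < ∞`, i.e. `Φ(2x) ≤ C Φ(x)`
for all large `x`. -/
def Delta2 (Φ : ℝ → ℝ) : Prop :=
  ∃ C x₀ : ℝ, ∀ x ≥ x₀, Φ (2 * x) ≤ C * Φ x

/-- The conjugate Young function `Φ*(y) = sup_x (x y − Φ x)`. -/
def conj (Φ : ℝ → ℝ) (y : ℝ) : ℝ := ⨆ x : ℝ, x * y - Φ x

variable (P : Measure Ω)

/-- Membership in the Orlicz space `L_Φ`: a measurable function with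
`E[Φ(l ξ)] < ∞` for some `l > 0`. -/
def MemOrlicz (Φ : ℝ → ℝ) (f : Ω → ℝ) : Prop :=
  Measurable f ∧ ∃ l : ℝ, 0 < l ∧ ∫⁻ ω, ENNReal.ofReal (Φ (l * f ω)) ∂P < ⊤

/-- The Orlicz space `L_Φ`, as a set of (everywhere defined) measurable functions. -/
def Orlicz (Φ : ℝ → ℝ) : Set (Ω → ℝ) := {f | MemOrlicz P Φ f}

/-- The Luxemburg norm `‖f‖_Φ = inf {l > 0 : E[Φ(f/l)] ≤ 1}`. -/
def luxNorm (Φ : ℝ → ℝ) (f : Ω → ℝ) : ℝ :=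
  sInf {l : ℝ | 0 < l ∧ ∫⁻ ω, ENNReal.ofReal (Φ (f ω / l)) ∂P ≤ 1}

/-- The Orlicz (dual) norm `‖f‖_{(Φ*)} = sup {E[g f] : E[Φ(g)] ≤ 1}`
(the Young function `Φ` here is the one of the *predual*). -/
def orliczNorm (Φ : ℝ → ℝ) (f : Ω → ℝ) : ℝ :=
  sSup {r : ℝ | ∃ g : Ω → ℝ, Measurable g ∧
    (∫⁻ ω, ENNReal.ofReal (Φ (g ω)) ∂P) ≤ 1 ∧ r = ∫ ω, g ω * f ω ∂P}

/-- The bilinear pairing `⟨f, g⟩ = E[f g]`. -/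
def pairing (f g : Ω → ℝ) : ℝ := ∫ ω, f ω * g ω ∂P

/-- The weak topology `σ(E, F)` on `E` induced by the pairing with `F`. -/
def weakT (E F : Set (Ω → ℝ)) : TopologicalSpace E :=
  TopologicalSpace.induced
    (fun ξ : E => fun η : F => pairing P (ξ : Ω → ℝ) (η : Ω → ℝ)) inferInstance

/-- The absolutely convex (convex and balanced) `σ(F,E)`-compact subsets of `F`. -/
def dualSets (E F : Set (Ω → ℝ)) : Set (Set F) :=
  {A | Convex ℝ (Subtype.val '' A) ∧ Balanced ℝ (Subtype.val '' A) ∧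
    @IsCompact _ (weakT P F E) A}

/-- The Mackey topology `τ(E, F)`: the topology on `E` of uniform convergence on
absolutely convex `σ(F,E)`-compact subsets of `F`. -/
def mackeyT (E F : Set (Ω → ℝ)) : TopologicalSpace E :=
  TopologicalSpace.induced
    (fun ξ : E => UniformOnFun.ofFun (dualSets P E F)
      (fun η : F => pairing P (ξ : Ω → ℝ) (η : Ω → ℝ)))
    inferInstance

/-- A distance generating the topology of convergence in `P`-probability. -/
def probDist (f g : Ω → ℝ) : ℝ := ∫ ω, min |f ω - g ω| 1 ∂P

/-- The topology of convergence in probability, restricted to `E ⊆ L₀`. -/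
def probT (E : Set (Ω → ℝ)) : TopologicalSpace E :=
  TopologicalSpace.generateFrom
    {U | ∃ f : E, ∃ ε : ℝ, 0 < ε ∧ U = {g : E | probDist P (f : Ω → ℝ) (g : Ω → ℝ) < ε}}

/-- `L_∞`: essentially bounded measurable functions. -/
def Linf : Set (Ω → ℝ) := {f | Measurable f ∧ ∃ C : ℝ, ∀ᵐ ω ∂P, |f ω| ≤ C}

/-- `L_1`: integrable measurable functions. -/
def L1 : Set (Ω → ℝ) := {f | Measurable f ∧ Integrable f P}

/-- The essential supremum norm. -/
def linfNorm (f : Ω → ℝ) : ℝ := sInf {C : ℝ | 0 ≤ C ∧ ∀ᵐ ω ∂P, |f ω| ≤ C}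

/-- Uniform integrability of a set of functions:
`sup_{f ∈ A} E[|f| 1_{|f| > N}] → 0`. -/
def UnifInt (A : Set (Ω → ℝ)) : Prop :=
  Tendsto (fun N : ℕ => ⨆ f ∈ A, ∫⁻ ω in {ω | (N : ℝ) < |f ω|}, ENNReal.ofReal |f ω| ∂P)
    atTop (𝓝 0)

/-- Uniform integrability of a sequence of functions. -/
def UnifIntSeq (g : ℕ → Ω → ℝ) : Prop :=
  Tendsto (fun N : ℕ => ⨆ n, ∫⁻ ω in {ω | (N : ℝ) < |g n ω|}, ENNReal.ofReal |g n ω| ∂P)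
    atTop (𝓝 0)

/-- The Cesàro means of a sequence of functions: `cesaro ξ N` is the average of
`ξ 0, …, ξ N`. -/
def cesaro (ξ : ℕ → Ω → ℝ) (N : ℕ) : Ω → ℝ :=
  fun ω => (∑ i ∈ Finset.range (N + 1), ξ i ω) / (N + 1)

/-- `sup_n |ξ n| ∈ L_Φ` (order boundedness of the sequence `ξ` in `L_Φ`). -/
def supMem (Φ : ℝ → ℝ) (ξ : ℕ → Ω → ℝ) : Prop :=
  (∀ᵐ ω ∂P, BddAbove (Set.range fun n => |ξ n ω|)) ∧
    MemOrlicz P Φ (fun ω => ⨆ n, |ξ n ω|)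

/-- `ξb` is a sequence of forward convex combinations of `ξ`:
`ξb n ∈ conv (ξ k ; k ≥ n)`. -/
def FwdConvComb (ξ ξb : ℕ → Ω → ℝ) : Prop :=
  ∀ n, ξb n ∈ convexHull ℝ {g : Ω → ℝ | ∃ k ≥ n, g = ξ k}

/-- The left derivative of a convex function. -/
def leftDeriv (Φ : ℝ → ℝ) (y : ℝ) : ℝ :=
  ⨆ h : {h : ℝ // 0 < h}, (Φ y - Φ (y - (h : ℝ))) / (h : ℝ)

/-- `p_Φ(x) = sup_{y > x} y Φ'(y) / Φ(y)`. -/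
def pPhiAt (Φ : ℝ → ℝ) (x : ℝ) : ℝ≥0∞ :=
  ⨆ y : {y : ℝ // x < y}, ENNReal.ofReal ((y : ℝ) * leftDeriv Φ (y : ℝ) / Φ (y : ℝ))

/-- `p_Φ = inf_{x ≥ 0} p_Φ(x)`. -/
def pPhi (Φ : ℝ → ℝ) : ℝ≥0∞ := ⨅ x : {x : ℝ // 0 ≤ x}, pPhiAt Φ x

/-- `q_Φ = p_Φ / (p_Φ − 1)` (with `1/0 = ∞`). -/
def qPhi (Φ : ℝ → ℝ) : ℝ≥0∞ := pPhi Φ / (pPhi Φ - 1)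

end OrliczPaper

namespace OrliczPaper

section YoungFunctions

variable {Φ : ℝ → ℝ}

lemma IsYoung.nonneg (hΦ : IsYoung Φ) (x : ℝ) : 0 ≤ Φ x := by
  have h := hΦ.convexOn.2 (mem_univ x) (mem_univ (-x))
    (show (0 : ℝ) ≤ 1/2 by norm_num) (show (0 : ℝ) ≤ 1/2 by norm_num) (by norm_num)
  simp only [smul_eq_mul, hΦ.even] at h
  rw [show (1/2 * x + 1/2 * -x : ℝ) = 0 by ring, hΦ.map_zero] at h
  linarith

lemma IsYoung.map_mul_le (hΦ : IsYoung Φ) {t : ℝ} (ht0 : 0 ≤ t) (ht1 : t ≤ 1) (x : ℝ) :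
    Φ (t * x) ≤ t * Φ x := by
  have h := hΦ.convexOn.2 (mem_univ x) (mem_univ 0)
    ht0 (sub_nonneg.2 ht1) (by ring)
  simpa [hΦ.map_zero] using h

lemma IsYoung.map_abs (hΦ : IsYoung Φ) (x : ℝ) : Φ |x| = Φ x := by
  rcases abs_choice x with h | h <;> rw [h]
  exact hΦ.even x

lemma IsYoung.mono_abs (hΦ : IsYoung Φ) {x y : ℝ} (h : |x| ≤ |y|) : Φ x ≤ Φ y := by
  rw [← hΦ.map_abs x, ← hΦ.map_abs y]
  rcases eq_or_lt_of_le (abs_nonneg y) with hy | hy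
  · have : |x| = 0 := le_antisymm (hy ▸ h) (abs_nonneg x)
    rw [this, ← hy]
  · have h1 : |x| / |y| ≤ 1 := (div_le_one hy).2 h
    have h2 := hΦ.map_mul_le (by positivity) h1 |y|
    rw [div_mul_cancel₀ _ hy.ne'] at h2
    exact h2.trans (mul_le_of_le_one_left (hΦ.nonneg _) h1)

lemma IsYoung.continuous (hΦ : IsYoung Φ) : Continuous Φ :=
  continuousOn_univ.1 (hΦ.convexOn.continuousOn isOpen_univ)

/-- Superlinear growth, with an additive constant. -/
lemma IsYoung.exists_mul_abs_le (hΦ : IsYoung Φ) (c : ℝ) :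
    ∃ M : ℝ, 0 ≤ M ∧ ∀ x, c * |x| ≤ M + Φ x := by
  obtain ⟨a, ha⟩ := eventually_atTop.1 (hΦ.coercive.eventually_ge_atTop c)
  refine ⟨|c| * max a 1, by positivity, fun x => ?_⟩
  rcases le_total (max a 1) |x| with h | h
  · have h1 := ha |x| ((le_max_left _ _).trans h)
    have hx : 0 < |x| := lt_of_lt_of_le one_pos ((le_max_right _ _).trans h)
    rw [le_div_iff₀ hx, hΦ.map_abs] at h1
    have : 0 ≤ |c| * max a 1 := by positivity
    linarith
  · have h1 : c * |x| ≤ |c| * max a 1 :=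
      mul_le_mul (le_abs_self c) h (abs_nonneg _) (abs_nonneg _)
    linarith [hΦ.nonneg x]

lemma IsYoung.exists_abs_le (hΦ : IsYoung Φ) {ε r : ℝ} (hε : 0 < ε) (hr : 0 < r) :
    ∃ M : ℝ, 0 ≤ M ∧ ∀ x, |x| ≤ M + ε * Φ (x / r) := by
  obtain ⟨M, hM, h⟩ := hΦ.exists_mul_abs_le (r / ε)
  refine ⟨ε * M, by positivity, fun x => ?_⟩
  have := mul_le_mul_of_nonneg_left (h (x / r)) hε.le
  rw [abs_div, abs_of_pos hr] at this
  have e : ε * (r / ε * (|x| / r)) = |x| := by field_simp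
  linarith

lemma IsYoung.bddAbove (hΦ : IsYoung Φ) (y : ℝ) :
    BddAbove (range fun x : ℝ => x * y - Φ x) := by
  obtain ⟨M, -, h⟩ := hΦ.exists_mul_abs_le |y|
  refine ⟨M, ?_⟩
  rintro _ ⟨x, rfl⟩
  have h1 : x * y ≤ |y| * |x| := by
    rw [← abs_mul, mul_comm]; exact le_abs_self _
  have := h x
  simp only
  linarith

lemma IsYoung.le_conj (hΦ : IsYoung Φ) (x y : ℝ) : x * y - Φ x ≤ conj Φ y :=
  le_ciSup (hΦ.bddAbove y) x

lemma IsYoung.abs_mul_le (hΦ : IsYoung Φ) (x y : ℝ) : |x * y| ≤ conj Φ x + Φ y := by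
  rcases abs_choice (x * y) with h | h <;> rw [h]
  · have := hΦ.le_conj y x
    linarith
  · have := hΦ.le_conj (-y) x
    rw [hΦ.even] at this
    linarith

lemma IsYoung.conj_isYoung (hΦ : IsYoung Φ) : IsYoung (conj Φ) where
  even y := by
    refine le_antisymm (ciSup_le fun x => ?_) (ciSup_le fun x => ?_)
    · have := hΦ.le_conj (-x) y
      rw [hΦ.even] at this
      linarith
    · have := hΦ.le_conj (-x) (-y)
      rw [hΦ.even] at this
      linarith
  convexOn := by
    refine ⟨convex_univ, fun y _ z _ a b ha hb hab => ciSup_le fun x => ?_⟩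
    have h1 := mul_le_mul_of_nonneg_left (hΦ.le_conj x y) ha
    have h2 := mul_le_mul_of_nonneg_left (hΦ.le_conj x z) hb
    simp only [smul_eq_mul]
    have e : Φ x = a * Φ x + b * Φ x := by rw [← add_mul, hab, one_mul]
    linarith
  map_zero := by
    refine le_antisymm (ciSup_le fun x => ?_) ?_
    · have := hΦ.nonneg x
      linarith
    · have := hΦ.le_conj 0 0
      rw [hΦ.map_zero] at this
      linarith
  coercive := by
    refine tendsto_atTop.2 fun b => ?_
    filter_upwards [eventually_ge_atTop (max 1 (Φ (b + 1)))] with y hy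
    have hy1 : 1 ≤ y := (le_max_left _ _).trans hy
    rw [le_div_iff₀ (by linarith)]
    have := hΦ.le_conj (b + 1) y
    have := (le_max_right 1 (Φ (b + 1))).trans hy
    linarith

/-- Under `Δ₂`, the conjugate function grows faster than some power `> 1`. -/
lemma IsYoung.exists_conj_mul_ge (hΦ : IsYoung Φ) (hΔ : Delta2 Φ) :
    ∃ lam : ℕ, 2 ≤ lam ∧ ∃ z₀ : ℝ, 0 ≤ z₀ ∧ ∀ z ≥ z₀,
      2 * lam * conj Φ z ≤ conj Φ (lam * z) := by
  obtain ⟨K, x₀, hK⟩ := hΔ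
  obtain ⟨n, hn⟩ := exists_nat_ge K
  set a : ℝ := max x₀ 0
  set lam : ℕ := n + 2
  refine ⟨lam, by omega, max 0 (Φ (a + 1) - Φ a), le_max_left _ _, fun z hz => ?_⟩
  have hz0 : 0 ≤ z := (le_max_left _ _).trans hz
  have hz1 : Φ (a + 1) - Φ a ≤ z := (le_max_right _ _).trans hz
  have hl : K ≤ 2 * (lam : ℝ) := by simp only [lam]; push_cast; linarith [n.cast_nonneg (α := ℝ)]
  have hl0 : (0 : ℝ) < 2 * lam := by positivity
  have large : ∀ x ≥ a, 2 * lam * (x * z - Φ x) ≤ conj Φ (lam * z) := by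
    intro x hx
    have h1 := hΦ.le_conj (2 * x) (lam * z)
    have h2 := hK x ((le_max_left _ _).trans hx)
    have h3 := mul_le_mul_of_nonneg_right hl (hΦ.nonneg x)
    linarith
  have key : ∀ x, x * z - Φ x ≤ conj Φ (lam * z) / (2 * lam) := by
    intro x
    rw [le_div_iff₀ hl0, mul_comm]
    rcases le_or_gt a x with hx | hx
    · exact large x hx
    · refine le_trans (mul_le_mul_of_nonneg_left ?_ hl0.le) (large a le_rfl)
      have hs := hΦ.convexOn.slope_mono_adjacent (mem_univ x) (mem_univ (a + 1)) hx (by linarith)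
      rw [add_sub_cancel_left, div_one, div_le_iff₀ (by linarith)] at hs
      have := mul_le_mul_of_nonneg_right hz1 (sub_nonneg.2 hx.le)
      linarith
  have := ciSup_le key
  rwa [le_div_iff₀ hl0, mul_comm] at this

/-- Under `Δ₂`, the quotients `y / (n + 1)` are damped by a summable factor. -/
lemma IsYoung.exists_conj_div_le (hΦ : IsYoung Φ) (hΔ : Delta2 Φ) :
    ∃ (ε : ℕ → ℝ) (K : ℝ), Summable ε ∧ (∀ n, 0 ≤ ε n) ∧ 0 ≤ K ∧
      ∀ (n : ℕ) y, conj Φ (y / (n + 1)) ≤ ε n * conj Φ y + K := by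
  obtain ⟨lam, hlam, z₀, hz₀, h⟩ := hΦ.exists_conj_mul_ge hΔ
  have hΨ := hΦ.conj_isYoung
  have hl : (2 : ℝ) ≤ lam := by exact_mod_cast hlam
  have iter : ∀ (j : ℕ), ∀ z ≥ z₀, (2 * lam) ^ j * conj Φ z ≤ conj Φ (lam ^ j * z) := by
    intro j
    induction j with
    | zero => intro z _; simp
    | succ j ih =>
      intro z hz
      have h1 : z₀ ≤ lam ^ j * z := by
        have : (1 : ℝ) ≤ lam ^ j := one_le_pow₀ (by linarith)
        nlinarith
      have h2 := h _ h1
      have h3 := mul_le_mul_of_nonneg_left (ih z hz) (show (0 : ℝ) ≤ 2 * lam by positivity)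
      calc (2 * lam : ℝ) ^ (j + 1) * conj Φ z = 2 * lam * ((2 * lam) ^ j * conj Φ z) := by ring
        _ ≤ _ := h3
        _ ≤ _ := h2
        _ = _ := by congr 1; ring
  set α : ℝ := Real.logb lam (2 * lam) with hα
  have hα1 : 1 < α := by
    rw [hα, Real.lt_logb_iff_rpow_lt (by linarith) (by linarith), Real.rpow_one]
    linarith
  have hlα : (lam : ℝ) ^ α = 2 * lam :=
    Real.rpow_logb (by linarith) (by linarith) (by linarith)
  refine ⟨fun n => 2 * lam * ((n : ℝ) + 1) ^ (-α), conj Φ z₀, ?_, fun n => by positivity,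
    hΨ.nonneg _, ?_⟩
  · apply Summable.mul_left
    have := (summable_nat_add_iff 1).2 (Real.summable_nat_rpow.2 (neg_lt_neg hα1))
    simpa using this
  intro n y
  set j := Nat.log lam (n + 1)
  have hj1 : lam ^ j ≤ n + 1 := Nat.pow_log_le_self _ (by omega)
  have hj2 : n + 1 < lam ^ (j + 1) := Nat.lt_pow_succ_log_self (by omega) _
  have hj1' : (lam : ℝ) ^ j ≤ n + 1 := by exact_mod_cast hj1
  have hj2' : (n : ℝ) + 1 ≤ (lam : ℝ) ^ (j + 1) := by exact_mod_cast hj2.le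
  have hpow : (0 : ℝ) < (lam : ℝ) ^ j := by positivity
  have hfac : ((2 * lam : ℝ) ^ j)⁻¹ ≤ 2 * lam * ((n : ℝ) + 1) ^ (-α) := by
    have h1 : ((n : ℝ) + 1) ^ α ≤ (2 * lam) ^ (j + 1) := by
      calc ((n : ℝ) + 1) ^ α ≤ ((lam : ℝ) ^ (j + 1)) ^ α :=
            Real.rpow_le_rpow (by positivity) hj2' (by linarith)
        _ = (2 * lam) ^ (j + 1) := by
            rw [← hlα, ← Real.rpow_natCast, ← Real.rpow_natCast, ← Real.rpow_mul (by positivity),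
              ← Real.rpow_mul (by positivity), mul_comm]
    rw [Real.rpow_neg (by positivity), inv_le_comm₀ (by positivity) (by positivity),
      mul_inv, inv_inv, ← div_eq_inv_mul, div_le_iff₀ (by positivity)]
    calc ((n : ℝ) + 1) ^ α ≤ _ := h1
      _ = _ := by ring
  have hred : conj Φ (y / (n + 1)) ≤ conj Φ (|y| / lam ^ j) := by
    apply hΨ.mono_abs
    rw [abs_div, abs_div, abs_abs, abs_of_pos hpow, abs_of_pos (by positivity : (0:ℝ) < n + 1)]
    gcongr
  refine hred.trans ?_
  have hnn : 0 ≤ 2 * lam * ((n : ℝ) + 1) ^ (-α) * conj Φ y :=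
    mul_nonneg (by positivity) (hΨ.nonneg _)
  rcases le_total z₀ (|y| / lam ^ j) with hz | hz
  · have h1 := iter j _ hz
    rw [mul_div_cancel₀ _ hpow.ne', hΨ.map_abs, ← le_inv_mul_iff₀ (by positivity)] at h1
    have := mul_le_mul_of_nonneg_right hfac (hΨ.nonneg y)
    linarith [hΨ.nonneg z₀]
  · have : conj Φ (|y| / lam ^ j) ≤ conj Φ z₀ := by
      apply hΨ.mono_abs
      rwa [abs_of_nonneg hz₀, abs_of_nonneg (by positivity)]
    linarith

end YoungFunctions

section ModularBalls

variable {Ω : Type*} [MeasurableSpace Ω] {P : Measure Ω} {Φ : ℝ → ℝ}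

/-- The functions of Luxemburg norm at most `r`, described through the modular. -/
def modBall (P : Measure Ω) (Φ : ℝ → ℝ) (r : ℝ) : Set (Ω → ℝ) :=
  {f | Measurable f ∧ ∫⁻ ω, ENNReal.ofReal (Φ (f ω / r)) ∂P ≤ 1}

lemma IsYoung.measurable_comp (hΦ : IsYoung Φ) {f : Ω → ℝ} (hf : Measurable f) (r : ℝ) :
    Measurable fun ω => ENNReal.ofReal (Φ (f ω / r)) :=
  (hΦ.continuous.measurable.comp (hf.div_const r)).ennreal_ofReal

lemma zero_mem_modBall (hΦ : IsYoung Φ) (r : ℝ) : (0 : Ω → ℝ) ∈ modBall P Φ r :=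
  ⟨measurable_zero, by simp [hΦ.map_zero]⟩

lemma convex_modBall (hΦ : IsYoung Φ) (r : ℝ) : Convex ℝ (modBall P Φ r) := by
  rintro f ⟨hf, hf1⟩ g ⟨hg, hg1⟩ a b ha hb hab
  refine ⟨(hf.const_smul a).add (hg.const_smul b), ?_⟩
  calc ∫⁻ ω, ENNReal.ofReal (Φ ((a • f + b • g) ω / r)) ∂P
      ≤ ∫⁻ ω, (ENNReal.ofReal a * ENNReal.ofReal (Φ (f ω / r)) +
          ENNReal.ofReal b * ENNReal.ofReal (Φ (g ω / r))) ∂P := by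
        refine lintegral_mono fun ω => ?_
        rw [← ENNReal.ofReal_mul ha, ← ENNReal.ofReal_mul hb,
          ← ENNReal.ofReal_add (mul_nonneg ha (hΦ.nonneg _)) (mul_nonneg hb (hΦ.nonneg _))]
        apply ENNReal.ofReal_le_ofReal
        have := hΦ.convexOn.2 (mem_univ (f ω / r)) (mem_univ (g ω / r)) ha hb hab
        simp only [smul_eq_mul] at this
        refine le_trans (le_of_eq ?_) this
        congr 1
        simp only [Pi.add_apply, Pi.smul_apply, smul_eq_mul]
        ring
    _ = ENNReal.ofReal a * ∫⁻ ω, ENNReal.ofReal (Φ (f ω / r)) ∂P +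
          ENNReal.ofReal b * ∫⁻ ω, ENNReal.ofReal (Φ (g ω / r)) ∂P := by
        rw [lintegral_add_left ((hΦ.measurable_comp hf r).const_mul _),
          lintegral_const_mul _ (hΦ.measurable_comp hf r),
          lintegral_const_mul _ (hΦ.measurable_comp hg r)]
    _ ≤ ENNReal.ofReal a * 1 + ENNReal.ofReal b * 1 := by gcongr
    _ = 1 := by rw [mul_one, mul_one, ← ENNReal.ofReal_add ha hb, hab, ENNReal.ofReal_one]

lemma neg_mem_modBall (hΦ : IsYoung Φ) {r : ℝ} {f : Ω → ℝ} (hf : f ∈ modBall P Φ r) :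
    -f ∈ modBall P Φ r := by
  refine ⟨hf.1.neg, ?_⟩
  simpa only [Pi.neg_apply, neg_div, hΦ.even] using hf.2

lemma modBall_mono (hΦ : IsYoung Φ) {r R : ℝ} (hr : 0 < r) (h : r ≤ R) :
    modBall P Φ r ⊆ modBall P Φ R := by
  rintro f ⟨hf, hf1⟩
  refine ⟨hf, le_trans (lintegral_mono fun ω => ENNReal.ofReal_le_ofReal (hΦ.mono_abs ?_)) hf1⟩
  rw [abs_div, abs_div, abs_of_pos hr, abs_of_pos (hr.trans_le h)]
  gcongr

lemma add_mem_modBall (hΦ : IsYoung Φ) {r : ℝ} {f g : Ω → ℝ} (hf : f ∈ modBall P Φ r)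
    (hg : g ∈ modBall P Φ r) : f + g ∈ modBall P Φ (2 * r) := by
  have h := convex_modBall hΦ r hf hg (show (0 : ℝ) ≤ 1/2 by norm_num)
    (show (0 : ℝ) ≤ 1/2 by norm_num) (by norm_num)
  refine ⟨hf.1.add hg.1, le_trans (le_of_eq ?_) h.2⟩
  congr 1
  funext ω
  congr 2
  simp only [Pi.add_apply, Pi.smul_apply, smul_eq_mul]
  rw [mul_comm 2 r, ← div_div]
  ring

lemma sub_mem_modBall (hΦ : IsYoung Φ) {r : ℝ} {f g : Ω → ℝ} (hf : f ∈ modBall P Φ r)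
    (hg : g ∈ modBall P Φ r) : f - g ∈ modBall P Φ (2 * r) := by
  rw [sub_eq_add_neg]
  exact add_mem_modBall hΦ hf (neg_mem_modBall hΦ hg)

lemma modBall_of_tendsto_ae (hΦ : IsYoung Φ) {r : ℝ} {f : ℕ → Ω → ℝ} {g : Ω → ℝ}
    (hf : ∀ n, f n ∈ modBall P Φ r) (hg : Measurable g)
    (h : ∀ᵐ ω ∂P, Tendsto (fun n => f n ω) atTop (𝓝 (g ω))) : g ∈ modBall P Φ r := by
  refine ⟨hg, ?_⟩
  calc ∫⁻ ω, ENNReal.ofReal (Φ (g ω / r)) ∂P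
      = ∫⁻ ω, liminf (fun n => ENNReal.ofReal (Φ (f n ω / r))) atTop ∂P := by
        refine lintegral_congr_ae ?_
        filter_upwards [h] with ω hω
        refine (Tendsto.liminf_eq ?_).symm
        exact (ENNReal.continuous_ofReal.tendsto _).comp
          ((hΦ.continuous.tendsto _).comp (hω.div_const r))
    _ ≤ liminf (fun n => ∫⁻ ω, ENNReal.ofReal (Φ (f n ω / r)) ∂P) atTop :=
        lintegral_liminf_le fun n => hΦ.measurable_comp (hf n).1 r
    _ ≤ liminf (fun _ : ℕ => (1 : ℝ≥0∞)) atTop :=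
        liminf_le_liminf (Eventually.of_forall fun n => (hf n).2)
    _ = 1 := by simp

lemma integrable_modular (hΦ : IsYoung Φ) {r : ℝ} {f : Ω → ℝ} (hf : f ∈ modBall P Φ r) :
    Integrable (fun ω => Φ (f ω / r)) P ∧ ∫ ω, Φ (f ω / r) ∂P ≤ 1 := by
  have hm : Measurable fun ω => Φ (f ω / r) := hΦ.continuous.measurable.comp (hf.1.div_const r)
  constructor
  · refine ⟨hm.aestronglyMeasurable, ?_⟩
    rw [hasFiniteIntegral_iff_ofReal (Eventually.of_forall fun ω => hΦ.nonneg _)]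
    exact hf.2.trans_lt ENNReal.one_lt_top
  · rw [integral_eq_lintegral_of_nonneg_ae (Eventually.of_forall fun ω => hΦ.nonneg _)
      hm.aestronglyMeasurable]
    exact ENNReal.toReal_mono ENNReal.one_ne_top hf.2

lemma integrable_of_mem_modBall [IsProbabilityMeasure P] (hΦ : IsYoung Φ) {r : ℝ} (hr : 0 < r)
    {f : Ω → ℝ} (hf : f ∈ modBall P Φ r) : Integrable f P := by
  obtain ⟨M, -, h⟩ := hΦ.exists_abs_le one_pos hr
  refine Integrable.mono' ((integrable_const M).add ((integrable_modular hΦ hf).1.const_mul 1))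
    hf.1.aestronglyMeasurable (Eventually.of_forall fun ω => ?_)
  simpa using h (f ω)

lemma exists_integral_abs_le [IsProbabilityMeasure P] (hΦ : IsYoung Φ) {r : ℝ} (hr : 0 < r) :
    ∃ M : ℝ, ∀ f ∈ modBall P Φ r, ∫ ω, |f ω| ∂P ≤ M := by
  obtain ⟨M, -, h⟩ := hΦ.exists_abs_le one_pos hr
  refine ⟨M + 1, fun f hf => ?_⟩
  have hi := integrable_modular hΦ hf
  calc ∫ ω, |f ω| ∂P ≤ ∫ ω, (M + Φ (f ω / r)) ∂P :=
        integral_mono (integrable_of_mem_modBall hΦ hr hf).abs ((integrable_const M).add hi.1)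
          fun ω => by simpa using h (f ω)
    _ = M + ∫ ω, Φ (f ω / r) ∂P := by
        rw [integral_add (integrable_const M) hi.1]; simp
    _ ≤ M + 1 := by linarith [hi.2]

/-- On modular balls, almost sure convergence implies convergence in mean. -/
lemma tendsto_integral_abs_sub [IsProbabilityMeasure P] (hΦ : IsYoung Φ) {r : ℝ} (hr : 0 < r)
    {f : ℕ → Ω → ℝ} {g : Ω → ℝ} (hf : ∀ n, f n ∈ modBall P Φ r) (hg : g ∈ modBall P Φ r)
    (h : ∀ᵐ ω ∂P, Tendsto (fun n => f n ω) atTop (𝓝 (g ω))) :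
    Tendsto (fun n => ∫ ω, |f n ω - g ω| ∂P) atTop (𝓝 0) := by
  have hd : ∀ n, f n - g ∈ modBall P Φ (2 * r) := fun n => sub_mem_modBall hΦ (hf n) hg
  have hInt : ∀ n, Integrable (fun ω => |f n ω - g ω|) P := fun n =>
    (integrable_of_mem_modBall hΦ (by positivity) (hd n)).abs
  rw [Metric.tendsto_atTop]
  intro ε hε
  obtain ⟨M, hM, hMx⟩ := hΦ.exists_abs_le (half_pos (half_pos hε)) (show 0 < 2 * r by positivity)
  -- truncation at level `2 * M`, past which the modular controls the absolute value
  have hbound : ∀ x, |x| ≤ min |x| (2 * M) + ε / 2 * Φ (x / (2 * r)) := by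
    intro x
    have := hMx x
    have := hΦ.nonneg (x / (2 * r))
    rcases le_total |x| (2 * M) with hx | hx
    · rw [min_eq_left hx]
      nlinarith
    · rw [min_eq_right hx]
      nlinarith
  have hmin : Tendsto (fun n => ∫ ω, min |f n ω - g ω| (2 * M) ∂P) atTop (𝓝 0) := by
    have := tendsto_integral_of_dominated_convergence (μ := P)
      (F := fun n ω => min |f n ω - g ω| (2 * M)) (f := fun _ => 0) (fun _ => 2 * M)
      (fun n => (((hf n).1.sub hg.1).abs.min measurable_const).aestronglyMeasurable)
      (integrable_const _)
      (fun n => Eventually.of_forall fun ω => by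
        rw [Real.norm_of_nonneg (le_min (abs_nonneg _) (by positivity))]
        exact min_le_right _ _)
      (by
        filter_upwards [h] with ω hω
        have h1 : Tendsto (fun n => |f n ω - g ω|) atTop (𝓝 0) := by
          have := (hω.sub_const (g ω)).abs
          simpa using this
        have := h1.min (tendsto_const_nhds (x := 2 * M))
        rwa [min_eq_left (by positivity)] at this)
    simpa using this
  obtain ⟨N, hN⟩ := eventually_atTop.1 (hmin.eventually (gt_mem_nhds (half_pos hε)))
  refine ⟨N, fun n hn => ?_⟩
  rw [Real.dist_0_eq_abs, abs_of_nonneg (integral_nonneg fun ω => abs_nonneg _)]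
  have hmod := integrable_modular hΦ (hd n)
  have hmi : Integrable (fun ω => min |f n ω - g ω| (2 * M)) P :=
    (hInt n).inf (integrable_const _)
  calc ∫ ω, |f n ω - g ω| ∂P
      ≤ ∫ ω, (min |f n ω - g ω| (2 * M) + ε / 2 * Φ ((f n - g) ω / (2 * r))) ∂P :=
        integral_mono (hInt n) (hmi.add (hmod.1.const_mul _)) fun ω => hbound _
    _ = ∫ ω, min |f n ω - g ω| (2 * M) ∂P + ε / 2 * ∫ ω, Φ ((f n - g) ω / (2 * r)) ∂P := by
        rw [integral_add hmi (hmod.1.const_mul _), integral_const_mul]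
    _ < ε / 2 + ε / 2 := by
        have := hN n hn
        have : ε / 2 * ∫ ω, Φ ((f n - g) ω / (2 * r)) ∂P ≤ ε / 2 :=
          mul_le_of_le_one_right (by positivity) hmod.2
        linarith
    _ = ε := by ring

end ModularBalls

section OrliczSpaces

variable {Ω : Type*} [MeasurableSpace Ω] {P : Measure Ω} {Φ : ℝ → ℝ}

lemma mem_orlicz_of_mem_modBall {r : ℝ} (hr : 0 < r) {f : Ω → ℝ}
    (hf : f ∈ modBall P Φ r) : f ∈ Orlicz P Φ := by
  refine ⟨hf.1, r⁻¹, inv_pos.2 hr, ?_⟩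
  simp only [← div_eq_inv_mul]
  exact hf.2.trans_lt ENNReal.one_lt_top

lemma exists_mem_modBall_of_lintegral_lt_top (hΦ : IsYoung Φ) {f : Ω → ℝ} (hf : Measurable f)
    {s : ℝ} (hs : 0 < s) (h : ∫⁻ ω, ENNReal.ofReal (Φ (f ω / s)) ∂P < ⊤) :
    ∃ R : ℝ, 0 < R ∧ f ∈ modBall P Φ R := by
  set m := (∫⁻ ω, ENNReal.ofReal (Φ (f ω / s)) ∂P).toReal
  have hm : 0 ≤ m := ENNReal.toReal_nonneg
  refine ⟨s * (m + 1), by positivity, hf, ?_⟩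
  calc ∫⁻ ω, ENNReal.ofReal (Φ (f ω / (s * (m + 1)))) ∂P
      ≤ ∫⁻ ω, ENNReal.ofReal (m + 1)⁻¹ * ENNReal.ofReal (Φ (f ω / s)) ∂P := by
        refine lintegral_mono fun ω => ?_
        rw [← ENNReal.ofReal_mul (by positivity)]
        apply ENNReal.ofReal_le_ofReal
        have := hΦ.map_mul_le (t := (m + 1)⁻¹) (by positivity)
          (inv_le_one_of_one_le₀ (by linarith)) (f ω / s)
        convert this using 2
        field_simp
    _ = ENNReal.ofReal (m + 1)⁻¹ * ENNReal.ofReal m := by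
        rw [lintegral_const_mul _ (hΦ.measurable_comp hf s), ENNReal.ofReal_toReal h.ne]
    _ ≤ 1 := by
        rw [← ENNReal.ofReal_mul (by positivity)]
        apply ENNReal.ofReal_le_one.2
        rw [inv_mul_le_iff₀ (by positivity)]
        linarith

lemma exists_mem_modBall (hΦ : IsYoung Φ) {f : Ω → ℝ} (hf : f ∈ Orlicz P Φ) :
    ∃ R : ℝ, 0 < R ∧ f ∈ modBall P Φ R := by
  obtain ⟨hm, l, hl, h⟩ := hf
  refine exists_mem_modBall_of_lintegral_lt_top hΦ hm (inv_pos.2 hl) ?_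
  simpa only [div_inv_eq_mul, mul_comm l] using h

lemma exists_mem_modBall_pair (hΦ : IsYoung Φ) {f g : Ω → ℝ} (hf : f ∈ Orlicz P Φ)
    (hg : g ∈ Orlicz P Φ) : ∃ R : ℝ, 0 < R ∧ f ∈ modBall P Φ R ∧ g ∈ modBall P Φ R := by
  obtain ⟨R, hR, h⟩ := exists_mem_modBall hΦ hf
  obtain ⟨R', hR', h'⟩ := exists_mem_modBall hΦ hg
  exact ⟨max R R', lt_max_of_lt_left hR, modBall_mono hΦ hR (le_max_left _ _) h,
    modBall_mono hΦ hR' (le_max_right _ _) h'⟩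

lemma orlicz_add (hΦ : IsYoung Φ) {f g : Ω → ℝ} (hf : f ∈ Orlicz P Φ)
    (hg : g ∈ Orlicz P Φ) : f + g ∈ Orlicz P Φ := by
  obtain ⟨R, hR, h, h'⟩ := exists_mem_modBall_pair hΦ hf hg
  exact mem_orlicz_of_mem_modBall (by positivity) (add_mem_modBall hΦ h h')

lemma orlicz_of_abs_le (hΦ : IsYoung Φ) {f g : Ω → ℝ} (hf : f ∈ Orlicz P Φ) (hg : Measurable g)
    (h : ∀ᵐ ω ∂P, |g ω| ≤ |f ω|) : g ∈ Orlicz P Φ := by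
  obtain ⟨-, l, hl, hlt⟩ := hf
  refine ⟨hg, l, hl, lt_of_le_of_lt (lintegral_mono_ae ?_) hlt⟩
  filter_upwards [h] with ω hω
  apply ENNReal.ofReal_le_ofReal
  apply hΦ.mono_abs
  rw [abs_mul, abs_mul]
  gcongr

lemma orlicz_const [IsProbabilityMeasure P] (c : ℝ) : (fun _ => c) ∈ Orlicz P Φ :=
  ⟨measurable_const, 1, one_pos, by simp⟩

lemma orlicz_const_mul {f : Ω → ℝ} (hf : f ∈ Orlicz P Φ) {c : ℝ} (hc : 0 < c) :
    (fun ω => c * f ω) ∈ Orlicz P Φ := by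
  obtain ⟨hm, l, hl, hlt⟩ := hf
  refine ⟨hm.const_mul c, l / c, by positivity, ?_⟩
  convert hlt using 5
  field_simp

lemma integrable_mul_of_mem_orlicz (hΦ : IsYoung Φ) {f g : Ω → ℝ}
    (hf : f ∈ Orlicz P (conj Φ)) (hg : g ∈ Orlicz P Φ) :
    Integrable (fun ω => f ω * g ω) P := by
  obtain ⟨r, hr, hf⟩ := exists_mem_modBall hΦ.conj_isYoung hf
  obtain ⟨s, hs, hg⟩ := exists_mem_modBall hΦ hg
  have h := (((integrable_modular hΦ.conj_isYoung hf).1.add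
    (integrable_modular hΦ hg).1).const_mul (r * s))
  refine Integrable.mono' h (hf.1.mul hg.1).aestronglyMeasurable
    (Eventually.of_forall fun ω => ?_)
  have h1 := mul_le_mul_of_nonneg_left (hΦ.abs_mul_le (f ω / r) (g ω / s))
    (show 0 ≤ r * s by positivity)
  have e : f ω * g ω = r * s * (f ω / r * (g ω / s)) := by field_simp
  rw [Real.norm_eq_abs, e, abs_mul, abs_of_pos (show 0 < r * s by positivity)]
  exact h1

end OrliczSpaces

section Selection

variable {Ω : Type*} [MeasurableSpace Ω] {P : Measure Ω}

lemma tendsto_setLIntegral_of_eventually_notMem {W : Ω → ℝ≥0∞} (hW : Measurable W)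
    (hfin : ∫⁻ ω, W ω ∂P ≠ ⊤) {A : ℕ → Set Ω} (hA : ∀ n, MeasurableSet (A n))
    (h : ∀ᵐ ω ∂P, ∀ᶠ n in atTop, ω ∉ A n) :
    Tendsto (fun n => ∫⁻ ω in A n, W ω ∂P) atTop (𝓝 0) := by
  have key := tendsto_lintegral_of_dominated_convergence (μ := P)
    (F := fun n => (A n).indicator W) (f := fun _ => 0) W
    (fun n => hW.indicator (hA n))
    (fun n => Eventually.of_forall fun ω => indicator_le_self _ _ _) hfin
    (by
      filter_upwards [h] with ω hω
      refine tendsto_const_nhds.congr' ?_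
      filter_upwards [hω] with n hn
      simp [hn])
  simpa [lintegral_indicator (hA _)] using key

/-- Passing to a subsequence along which a condition relating each chosen index to all
previously chosen ones holds. -/
lemma exists_strictMono_forall_lt {Q : ℕ → ℕ → ℕ → Prop}
    (h : ∀ i m, ∀ᶠ n in atTop, Q i m n) :
    ∃ φ : ℕ → ℕ, StrictMono φ ∧ ∀ i, ∀ j < i, Q i (φ j) (φ i) := by
  have h' : ∀ i m, ∃ N, ∀ n ≥ N, ∀ l ≤ m, Q i l n := by
    intro i m
    have : ∀ᶠ n in atTop, ∀ l ∈ Finset.range (m + 1), Q i l n :=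
      (Finset.eventually_all _).2 fun l _ => h i l
    obtain ⟨N, hN⟩ := eventually_atTop.1 this
    exact ⟨N, fun n hn l hl => hN n hn l (Finset.mem_range.2 (by omega))⟩
  choose N hN using h'
  let φ : ℕ → ℕ := fun i => Nat.rec 0 (fun i m => max (m + 1) (N (i + 1) m)) i
  have hφ : ∀ i, φ (i + 1) = max (φ i + 1) (N (i + 1) (φ i)) := fun i => rfl
  have hmono : StrictMono φ := strictMono_nat_of_lt_succ fun i => by
    rw [hφ]; exact lt_of_lt_of_le (Nat.lt_succ_self _) (le_max_left _ _)
  refine ⟨φ, hmono, fun i j hji => ?_⟩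
  obtain ⟨i, rfl⟩ : ∃ k, i = k + 1 := ⟨i - 1, by omega⟩
  exact hN (i + 1) (φ i) _ (by rw [hφ]; exact le_max_right _ _) _
    (hmono.monotone (by omega))

end Selection

section Schur

/-- A form of Schur's theorem: on a set which is compact for the topology of convergence of all
subseries, the coordinates converge to zero uniformly. -/
lemma tendsto_diag_of_isCompact {X : Type*} [TopologicalSpace X] {A : Set X} (hA : IsCompact A)
    {x : X → ℕ → ℝ} (hsum : ∀ η, Summable (x η))
    (hcont : ∀ c : ℕ → Bool, Continuous fun η => ∑' j, if c j then x η j else 0)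
    {η : ℕ → X} (hη : ∀ k, η k ∈ A) : Tendsto (fun k => x (η k) k) atTop (𝓝 0) := by
  set y : (ℕ → Bool) → X → ℝ := fun c η => ∑' j, if c j then x η j else 0 with hy
  have hsumc : ∀ (c : ℕ → Bool) η, Summable fun j => if c j then x η j else 0 := fun c η =>
    Summable.of_norm_bounded (hsum η).norm fun j => by split_ifs <;> simp
  have hcoord : ∀ j, Continuous fun η => x η j := by
    intro j
    convert hcont (fun i => decide (i = j)) using 2 with η
    simp
  have hyc : ∀ η, Continuous fun c => y c η := by
    intro η
    refine continuous_tsum (u := fun j => ‖x η j‖) (fun j => ?_) (hsum η).norm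
      (fun j c => by split_ifs <;> simp)
    exact (continuous_of_discreteTopology (f := fun b : Bool => if b then x η j else 0)).comp
      (continuous_apply j)
  by_contra hnot
  rw [Metric.tendsto_atTop] at hnot
  push Not at hnot
  obtain ⟨ε, hε, hfreq⟩ := hnot
  obtain ⟨φ, hφ, hφε⟩ := extraction_of_frequently_atTop
    (P := fun k => ε ≤ dist (x (η k) k) 0) (frequently_atTop.2 hfreq)
  have hK : IsCompact ((fun η => x η) '' A) := hA.image (continuous_pi hcoord)
  obtain ⟨-, ⟨θ, -, rfl⟩, ψ, hψ, hlim⟩ := hK.tendsto_subseq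
    (x := fun k => x (η (φ k))) fun k => ⟨_, hη _, rfl⟩
  set σ : ℕ → ℕ := φ ∘ ψ
  have hσ : StrictMono σ := hφ.comp hψ
  have hweak : ∀ c, Tendsto (fun k => y c (η (σ k))) atTop (𝓝 (y c θ)) := by
    intro c
    rw [tendsto_iff_ultrafilter]
    intro U hU
    obtain ⟨θ', -, hθ'⟩ := hA.ultrafilter_le_nhds (U.map fun k => η (σ k))
      (by simp only [le_principal_iff, Ultrafilter.mem_coe, Ultrafilter.mem_map]
          exact univ_mem' fun k => hη _)
    have hθ'' : Tendsto (fun k => η (σ k)) U (𝓝 θ') := hθ'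
    have hco : ∀ j, x θ' j = x θ j := fun j =>
      tendsto_nhds_unique (((hcoord j).tendsto θ').comp hθ'')
        (((continuous_apply j).tendsto _).comp (hlim.mono_left hU))
    have : y c θ = y c θ' := by simp only [hy, hco]
    rw [this]
    exact ((hcont c).tendsto θ').comp hθ''
  have hclosed : ∀ m : ℕ, IsClosed {c | ∀ k ≥ m, |y c (η (σ k)) - y c θ| ≤ ε / 8} := by
    intro m
    simp only [Set.ofPred_forall]
    exact isClosed_iInter fun k => isClosed_iInter fun _ =>
      isClosed_le ((hyc _).sub (hyc _)).abs continuous_const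
  have hcover : ⋃ m : ℕ, {c | ∀ k ≥ m, |y c (η (σ k)) - y c θ| ≤ ε / 8} = univ := by
    refine eq_univ_of_forall fun c => mem_iUnion.2 ?_
    obtain ⟨m, hm⟩ := Metric.tendsto_atTop.1 (hweak c) (ε / 8) (by positivity)
    exact ⟨m, fun k hk => (hm k hk).le⟩
  obtain ⟨m, c, hc⟩ := nonempty_interior_of_iUnion_of_closed hclosed hcover
  have hflip : Tendsto (fun j => Function.update c j (!c j)) atTop (𝓝 c) := by
    rw [tendsto_pi_nhds]
    intro i
    refine tendsto_const_nhds.congr' ?_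
    filter_upwards [eventually_gt_atTop i] with j hj
    rw [Function.update_of_ne hj.ne]
  have hyflip : ∀ j η, |x η j| = |y (Function.update c j (!c j)) η - y c η| := by
    intro j η
    simp only [hy]
    rw [← (hsumc _ η).tsum_sub (hsumc _ η), tsum_eq_single j]
    · simp only [Function.update_self]
      cases c j <;> simp
    · intro i hi
      simp [Function.update_of_ne hi]
  have hev : ∀ᶠ k in atTop, |x (η (σ k)) (σ k)| < ε := by
    have h1 := (hσ.tendsto_atTop).eventually
      (hflip.eventually (mem_interior_iff_mem_nhds.1 hc))
    have h2 := (hσ.tendsto_atTop).eventually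
      ((hsum θ).tendsto_atTop_zero.eventually (Metric.ball_mem_nhds 0 (half_pos hε)))
    filter_upwards [h1, h2, eventually_ge_atTop m] with k h1 h2 hk
    have a1 := h1 k hk
    have a2 := interior_subset hc k hk
    have a3 : |x θ (σ k)| < ε / 2 := by simpa using h2
    rw [hyflip] at a3 ⊢
    rw [abs_le] at a1 a2
    rw [abs_lt] at a3 ⊢
    constructor <;> linarith
  obtain ⟨k, hk⟩ := hev.exists
  have := hφε (ψ k)
  rw [Real.dist_0_eq_abs] at this
  exact absurd hk (not_lt.2 this)

end Schur

lemma sum_ite_last_le {A : ℕ → Prop} [∀ j, Decidable (A j ∧ ∀ i > j, ¬ A i)] (s : Finset ℕ)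
    (a : ℕ → ℝ) {M : ℝ} (hM : 0 ≤ M) (h : ∀ j ∈ s, A j → (∀ i > j, ¬ A i) → a j ≤ M) :
    ∑ j ∈ s, (if A j ∧ ∀ i > j, ¬ A i then a j else 0) ≤ M := by
  by_cases hex : ∃ j ∈ s, A j ∧ ∀ i > j, ¬ A i
  · obtain ⟨j, hjs, hj⟩ := hex
    rw [Finset.sum_eq_single_of_mem j hjs, if_pos hj]
    · exact h j hjs hj.1 hj.2
    · intro i _ hij
      rw [if_neg]
      rintro ⟨hi, hi'⟩
      rcases lt_or_gt_of_ne hij with hlt | hgt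
      · exact hi' j hlt hj.1
      · exact hj.2 i hgt hi
  · push Not at hex
    rw [Finset.sum_eq_zero]
    · exact hM
    · intro j hj
      rw [if_neg]
      rintro ⟨h1, h2⟩
      obtain ⟨i, hi, hAi⟩ := hex j hj h1
      exact h2 i hi hAi

section Mackey

variable {Ω : Type*} [MeasurableSpace Ω] {P : Measure Ω} {Φ : ℝ → ℝ}

lemma continuous_pairing_right {E F : Set (Ω → ℝ)} {u : Ω → ℝ} (hu : u ∈ E) :
    @Continuous F ℝ (weakT P F E) _ fun η => pairing P (η : Ω → ℝ) u := by
  have h1 : Continuous fun f : E → ℝ => f ⟨u, hu⟩ := continuous_apply _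
  have h2 : @Continuous F (E → ℝ) (weakT P F E) _
      (fun η : F => fun ξ : E => pairing P (η : Ω → ℝ) (ξ : Ω → ℝ)) := continuous_induced_dom
  have h3 := @Continuous.comp _ _ _ (weakT P F E) _ _ _ _ h1 h2
  exact h3

lemma tsum_mem_orlicz (hΦ : IsYoung Φ) {v : ℕ → Ω → ℝ} (hv : ∀ j, Measurable (v j)) {Z : Ω → ℝ}
    (hZ : Z ∈ Orlicz P Φ) (hvZ : ∀ (s : Finset ℕ) ω, ∑ j ∈ s, |v j ω| ≤ Z ω) :
    (fun ω => ∑' j, v j ω) ∈ Orlicz P Φ := by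
  have hvs : ∀ ω, Summable fun j => |v j ω| := fun ω =>
    summable_of_sum_le (fun _ => abs_nonneg _) fun s => hvZ s ω
  refine orlicz_of_abs_le hΦ hZ ?_ (Eventually.of_forall fun ω => ?_)
  · refine measurable_of_tendsto_metrizable (f := fun n ω => ∑ j ∈ Finset.range n, v j ω)
      (fun n => Finset.measurable_fun_sum _ fun j _ => hv j) ?_
    rw [tendsto_pi_nhds]
    exact fun ω => (hvs ω).of_abs.hasSum.tendsto_sum_nat
  · have h1 : ‖∑' j, v j ω‖ ≤ ∑' j, ‖v j ω‖ := norm_tsum_le_tsum_norm (hvs ω)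
    have h2 : ∑' j, ‖v j ω‖ ≤ Z ω :=
      Real.tsum_le_of_sum_le (fun _ => norm_nonneg _) fun s => hvZ s ω
    exact (h1.trans h2).trans (le_abs_self _)

lemma hasSum_pairing {v : ℕ → Ω → ℝ} (hv : ∀ j, Measurable (v j)) {Z η : Ω → ℝ}
    (hη : Measurable η) (hηZ : Integrable (fun ω => η ω * Z ω) P)
    (hvZ : ∀ (s : Finset ℕ) ω, ∑ j ∈ s, |v j ω| ≤ Z ω) :
    HasSum (fun j => pairing P η (v j)) (pairing P η fun ω => ∑' j, v j ω) := by
  have hZ0 : ∀ ω, 0 ≤ Z ω := fun ω => by simpa using hvZ ∅ ω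
  have habs : Integrable (fun ω => |η ω| * Z ω) P :=
    hηZ.abs.congr (Eventually.of_forall fun ω => by simp only [abs_mul, abs_of_nonneg (hZ0 ω)])
  have hInt : ∀ j, Integrable (fun ω => η ω * v j ω) P := fun j =>
    habs.mono' (hη.mul (hv j)).aestronglyMeasurable (Eventually.of_forall fun ω => by
      rw [Real.norm_eq_abs, abs_mul]
      exact mul_le_mul_of_nonneg_left (by simpa using hvZ {j} ω) (abs_nonneg _))
  have := hasSum_integral_of_summable_integral_norm hInt
    (summable_of_sum_le (c := ∫ ω, |η ω| * Z ω ∂P)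
      (fun j => integral_nonneg fun ω => norm_nonneg _) fun s => by
        rw [← integral_finsetSum s fun j _ => (hInt j).norm]
        refine integral_mono (integrable_finsetSum _ fun j _ => (hInt j).norm) habs fun ω => ?_
        simp only [norm_mul, Real.norm_eq_abs, ← Finset.mul_sum]
        exact mul_le_mul_of_nonneg_left (hvZ s ω) (abs_nonneg _))
  simpa only [pairing, tsum_mul_left] using this

lemma tendsto_pairing_of_sum_le (hΦ : IsYoung Φ) {A : Set (Orlicz P Φ)}
    (hA : @IsCompact _ (weakT P (Orlicz P Φ) (Orlicz P (conj Φ))) A)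
    {u : ℕ → Ω → ℝ} (hu : ∀ j, Measurable (u j)) {Z : Ω → ℝ} (hZ : Z ∈ Orlicz P (conj Φ))
    (huZ : ∀ (s : Finset ℕ) ω, ∑ j ∈ s, |u j ω| ≤ Z ω)
    {η : ℕ → Orlicz P Φ} (hη : ∀ k, η k ∈ A) :
    Tendsto (fun k => pairing P (u k) (η k)) atTop (𝓝 0) := by
  have hηZ : ∀ η : Orlicz P Φ, Integrable (fun ω => (η : Ω → ℝ) ω * Z ω) P := fun η => by
    simpa only [mul_comm] using integrable_mul_of_mem_orlicz hΦ hZ η.2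
  set v : (ℕ → Bool) → ℕ → Ω → ℝ := fun c j ω => if c j then u j ω else 0 with hv
  have hvm : ∀ c j, Measurable (v c j) := fun c j => by
    simp only [hv]; split_ifs
    exacts [hu j, measurable_const]
  have hvZ : ∀ c (s : Finset ℕ) ω, ∑ j ∈ s, |v c j ω| ≤ Z ω := fun c s ω =>
    (Finset.sum_le_sum fun j _ => by simp only [hv]; split_ifs <;> simp).trans (huZ s ω)
  have hx : ∀ (c : ℕ → Bool) (η : Orlicz P Φ), (∑' j, if c j then pairing P η (u j) else 0) =
      pairing P η (fun ω => ∑' j, v c j ω) := by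
    intro c η
    rw [← (hasSum_pairing (hvm c) η.2.1 (hηZ η) (hvZ c)).tsum_eq]
    congr 1 with j
    simp only [hv]
    split_ifs <;> simp [pairing]
  have := @tendsto_diag_of_isCompact _ (weakT P (Orlicz P Φ) (Orlicz P (conj Φ))) _ hA
    (fun η j => pairing P η (u j)) (fun η => (hasSum_pairing hu η.2.1 (hηZ η) huZ).summable)
    (fun c => by
      simp only [hx]
      exact continuous_pairing_right (tsum_mem_orlicz hΦ.conj_isYoung (hvm c) hZ (hvZ c))) _ hη
  simpa only [pairing, mul_comm] using this

end Mackey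

section Mackey

variable {Ω : Type*} [MeasurableSpace Ω] {P : Measure Ω} {Φ : ℝ → ℝ}

lemma eventually_pairing_lt_of_forall_abs_le (hΦ : IsYoung Φ) {A : Set (Orlicz P Φ)}
    (hA : @IsCompact _ (weakT P (Orlicz P Φ) (Orlicz P (conj Φ))) A)
    {g : ℕ → Ω → ℝ} (hg : ∀ j, Measurable (g j)) {ζ : Ω → ℝ} (hζ : ζ ∈ Orlicz P (conj Φ))
    (hζ0 : ∀ ω, 0 < ζ ω) (hgζ : ∀ n ω, |g n ω| ≤ ζ ω)
    (hlim : ∀ᵐ ω ∂P, Tendsto (fun n => g n ω) atTop (𝓝 0)) {ε : ℝ} (hε : 0 < ε) :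
    ∀ᶠ n in atTop, ∀ η ∈ A, |pairing P (g n) η| < ε := by
  classical
  by_contra hnot
  rw [not_eventually] at hnot
  obtain ⟨φ, hφ, hφε⟩ := extraction_of_frequently_atTop hnot
  push Not at hφε
  choose η hηA hηε using hφε
  set W : ℕ → Ω → ℝ≥0∞ := fun m ω => ENNReal.ofReal |ζ ω * (η m : Ω → ℝ) ω| with hWdef
  have hWm : ∀ m, Measurable (W m) := fun m =>
    ((hζ.1.mul (η m).2.1).abs).ennreal_ofReal
  have hWfin : ∀ m, ∫⁻ ω, W m ω ∂P ≠ ⊤ := fun m =>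
    (integrable_mul_of_mem_orlicz hΦ hζ (η m).2).abs.lintegral_lt_top.ne
  set S : ℕ → ℕ → Set Ω := fun i n => {ω | (2⁻¹ : ℝ) ^ i * ζ ω < |g (φ n) ω|} with hS
  have hSm : ∀ i n, MeasurableSet (S i n) := fun i n =>
    measurableSet_lt (hζ.1.const_mul _) (hg _).abs
  have hSev : ∀ i, ∀ᵐ ω ∂P, ∀ᶠ n in atTop, ω ∉ S i n := by
    intro i
    filter_upwards [hlim] with ω hω
    have h1 := (hω.comp hφ.tendsto_atTop).abs
    rw [abs_zero] at h1
    have h2 : 0 < (2⁻¹ : ℝ) ^ i * ζ ω := mul_pos (by positivity) (hζ0 ω)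
    filter_upwards [h1.eventually (gt_mem_nhds h2)] with n hn
    simpa [hS] using hn.le
  obtain ⟨ψ, hψ, hψQ⟩ := exists_strictMono_forall_lt
    (Q := fun i m n => ∫⁻ ω in S i n, W m ω ∂P ≤ ENNReal.ofReal (ε / 4) * 2⁻¹ ^ i)
    (fun i m => by
      have h0 : (0 : ℝ≥0∞) < ENNReal.ofReal (ε / 4) * 2⁻¹ ^ i :=
        ENNReal.mul_pos (by simpa using hε) (pow_ne_zero _ (by simp))
      exact (tendsto_setLIntegral_of_eventually_notMem (hWm m) (hWfin m) (hSm i)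
        (hSev i)).eventually (ge_mem_nhds h0))
  set B : ℕ → Set Ω := fun i => S i (ψ i) with hB
  have hBm : ∀ i, MeasurableSet (B i) := fun i => hSm _ _
  set N : ℕ → Set Ω := fun j => B j ∩ ⋃ i, ⋃ (_ : j < i), B i with hN
  have hNm : ∀ j, MeasurableSet (N j) := fun j =>
    (hBm j).inter (MeasurableSet.iUnion fun i => MeasurableSet.iUnion fun _ => hBm i)
  set u : ℕ → Ω → ℝ := fun j => (N j)ᶜ.indicator (g (φ (ψ j))) with hu
  have hum : ∀ j, Measurable (u j) := fun j => (hg _).indicator (hNm j).compl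
  have hub : ∀ j ω, |u j ω| ≤ (1 / 2) ^ j * ζ ω +
      if ω ∈ B j ∧ ∀ i > j, ω ∉ B i then ζ ω else 0 := by
    intro j ω
    have h0 : 0 ≤ ((1 / 2 : ℝ)) ^ j * ζ ω := mul_nonneg (by positivity) (hζ0 ω).le
    have h1 : 0 ≤ if ω ∈ B j ∧ ∀ i > j, ω ∉ B i then ζ ω else 0 := by
      split_ifs
      exacts [(hζ0 ω).le, le_rfl]
    by_cases hω : ω ∈ N j
    · simp only [hu, indicator_of_notMem (notMem_compl_iff.2 hω), abs_zero]
      positivity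
    · simp only [hu, indicator_of_mem (mem_compl hω)]
      by_cases hj : ω ∈ B j
      · rw [if_pos ⟨hj, fun i hi hi' => hω ⟨hj, mem_iUnion₂.2 ⟨i, hi, hi'⟩⟩⟩]
        have := hgζ (φ (ψ j)) ω
        linarith
      · have : |g (φ (ψ j)) ω| ≤ (2⁻¹ : ℝ) ^ j * ζ ω := by simpa [hB, hS] using hj
        rw [one_div]
        rw [one_div] at h0
        linarith
  have hsum : ∀ (s : Finset ℕ) ω, ∑ j ∈ s, |u j ω| ≤ 3 * ζ ω := by
    intro s ω
    have h1 : ∑ j ∈ s, (1 / 2 : ℝ) ^ j ≤ 2 :=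
      (summable_geometric_two.sum_le_tsum s fun i _ => by positivity).trans
        tsum_geometric_two.le
    have h2 := sum_ite_last_le (A := fun j => ω ∈ B j) s (fun _ => ζ ω) (hζ0 ω).le
      fun _ _ _ _ => le_rfl
    refine (Finset.sum_le_sum fun j _ => hub j ω).trans ?_
    rw [Finset.sum_add_distrib, ← Finset.sum_mul]
    have := mul_le_mul_of_nonneg_right h1 (hζ0 ω).le
    linarith
  have htend := tendsto_pairing_of_sum_le hΦ hA hum (orlicz_const_mul hζ three_pos) hsum
    (η := fun k => η (ψ k)) fun k => hηA _
  have hdiff : ∀ j, |∫ ω in N j, g (φ (ψ j)) ω * (η (ψ j) : Ω → ℝ) ω ∂P| ≤ ε / 2 := by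
    intro j
    have h1 : ∫⁻ ω in N j, W (ψ j) ω ∂P ≤ ENNReal.ofReal (ε / 2) := by
      calc ∫⁻ ω in N j, W (ψ j) ω ∂P
          ≤ ∫⁻ ω in ⋃ i, ⋃ (_ : j < i), B i, W (ψ j) ω ∂P :=
            lintegral_mono_set inter_subset_right
        _ ≤ ∑' i, ∫⁻ ω in ⋃ (_ : j < i), B i, W (ψ j) ω ∂P := lintegral_iUnion_le _ _
        _ ≤ ∑' i, ENNReal.ofReal (ε / 4) * 2⁻¹ ^ i := by
            refine ENNReal.tsum_le_tsum fun i => ?_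
            by_cases hi : j < i
            · simpa [hi] using hψQ i j hi
            · simp [hi]
        _ = ENNReal.ofReal (ε / 2) := by
            rw [ENNReal.tsum_mul_left, ENNReal.tsum_geometric_two,
              ← ENNReal.ofReal_ofNat 2, ← ENNReal.ofReal_mul (by positivity)]
            congr 1
            ring
    rw [← Real.norm_eq_abs, ← ENNReal.ofReal_le_ofReal_iff (by positivity), ofReal_norm]
    refine (enorm_integral_le_lintegral_enorm _).trans (le_trans (lintegral_mono fun ω => ?_) h1)
    rw [← ofReal_norm, hWdef, Real.norm_eq_abs, abs_mul]
    simp only [abs_mul, abs_of_pos (hζ0 ω)]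
    gcongr
    exact hgζ _ _
  obtain ⟨j, hj⟩ := (htend.eventually (Metric.ball_mem_nhds 0 (half_pos hε))).exists
  have hgO : g (φ (ψ j)) ∈ Orlicz P (conj Φ) :=
    orlicz_of_abs_le hΦ.conj_isYoung hζ (hg _)
      (Eventually.of_forall fun ω => (hgζ _ ω).trans (le_abs_self _))
  have hsplit : pairing P (g (φ (ψ j))) (η (ψ j)) = pairing P (u j) (η (ψ j)) +
      ∫ ω in N j, g (φ (ψ j)) ω * (η (ψ j) : Ω → ℝ) ω ∂P := by
    rw [pairing, pairing, ← integral_add_compl (hNm j) (integrable_mul_of_mem_orlicz hΦ hgO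
      (η (ψ j)).2), add_comm, ← integral_indicator (hNm j).compl]
    congr 2
    funext ω
    by_cases hω : ω ∈ (N j)ᶜ <;> simp [hu, hω]
  have h1 := hηε (ψ j)
  have h2 := abs_add_le (pairing P (u j) (η (ψ j)))
    (∫ ω in N j, g (φ (ψ j)) ω * (η (ψ j) : Ω → ℝ) ω ∂P)
  rw [← hsplit] at h2
  have h3 : |pairing P (u j) (η (ψ j))| < ε / 2 := by simpa using hj
  linarith [hdiff j]

/-- A sequence which is dominated in `L_{Φ*}` and tends to zero almost everywhere tends to zero
uniformly on `σ(L_Φ, L_{Φ*})`-compact sets. -/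
lemma eventually_pairing_lt (hΦ : IsYoung Φ) {A : Set (Orlicz P Φ)}
    (hA : @IsCompact _ (weakT P (Orlicz P Φ) (Orlicz P (conj Φ))) A)
    {g : ℕ → Ω → ℝ} (hg : ∀ j, Measurable (g j)) {ζ : Ω → ℝ} (hζ : ζ ∈ Orlicz P (conj Φ))
    (hζ0 : ∀ ω, 0 < ζ ω) (hgζ : ∀ n, ∀ᵐ ω ∂P, |g n ω| ≤ ζ ω)
    (hlim : ∀ᵐ ω ∂P, Tendsto (fun n => g n ω) atTop (𝓝 0)) {ε : ℝ} (hε : 0 < ε) :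
    ∀ᶠ n in atTop, ∀ η ∈ A, |pairing P (g n) η| < ε := by
  set D : ℕ → Set Ω := fun n => {ω | |g n ω| ≤ ζ ω}
  have hD : ∀ n, MeasurableSet (D n) := fun n => measurableSet_le (hg n).abs hζ.1
  have hDg : ∀ n, (D n).indicator (g n) =ᵐ[P] g n := fun n => by
    filter_upwards [hgζ n] with ω hω
    exact indicator_of_mem (show ω ∈ D n from hω) (g n)
  have := eventually_pairing_lt_of_forall_abs_le hΦ hA (g := fun n => (D n).indicator (g n))
    (fun n => (hg n).indicator (hD n)) hζ hζ0 (fun n ω => by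
      by_cases hω : ω ∈ D n
      · rw [indicator_of_mem hω]; exact hω
      · rw [indicator_of_notMem hω, abs_zero]; exact (hζ0 ω).le)
    (by
      filter_upwards [hlim, ae_all_iff.2 hDg] with ω h1 h2
      exact h1.congr fun n => (h2 n).symm) hε
  filter_upwards [this] with n hn η hη
  have heq : pairing P ((D n).indicator (g n)) η = pairing P (g n) η :=
    integral_congr_ae ((hDg n).mul (ae_eq_refl _))
  rw [← heq]
  exact hn η hη

end Mackey

section Mackey

variable {Ω : Type*} [MeasurableSpace Ω] {P : Measure Ω} {Φ : ℝ → ℝ}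

lemma tendsto_mackeyT_of_dominated (hΦ : IsYoung Φ) {ξ : ℕ → Orlicz P (conj Φ)}
    {ξ₀ : Orlicz P (conj Φ)} {ζ : Ω → ℝ} (hζ : ζ ∈ Orlicz P (conj Φ)) (hζ0 : ∀ ω, 0 < ζ ω)
    (hdom : ∀ n, ∀ᵐ ω ∂P, |(ξ n : Ω → ℝ) ω - (ξ₀ : Ω → ℝ) ω| ≤ ζ ω)
    (hlim : ∀ᵐ ω ∂P, Tendsto (fun n => (ξ n : Ω → ℝ) ω) atTop (𝓝 ((ξ₀ : Ω → ℝ) ω))) :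
    Tendsto ξ atTop (@nhds _ (mackeyT P (Orlicz P (conj Φ)) (Orlicz P Φ)) ξ₀) := by
  rw [mackeyT, nhds_induced, tendsto_comap_iff, UniformOnFun.tendsto_iff_tendstoUniformlyOn]
  rintro A ⟨-, -, hA⟩
  rw [Metric.tendstoUniformlyOn_iff]
  intro ε hε
  filter_upwards [eventually_pairing_lt hΦ hA
    (g := fun n ω => (ξ n : Ω → ℝ) ω - (ξ₀ : Ω → ℝ) ω) (fun n => (ξ n).2.1.sub ξ₀.2.1)
    hζ hζ0 hdom (by
      filter_upwards [hlim] with ω hω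
      simpa using hω.sub_const ((ξ₀ : Ω → ℝ) ω)) hε] with n hn η hη
  have := hn η hη
  rw [dist_comm, Real.dist_eq]
  simp only [pairing, sub_mul] at this
  rw [integral_sub (integrable_mul_of_mem_orlicz hΦ (ξ n).2 η.2)
    (integrable_mul_of_mem_orlicz hΦ ξ₀.2 η.2)] at this
  exact this

end Mackey

section Cesaro

variable {Ω : Type*} [MeasurableSpace Ω] {P : Measure Ω} {Ψ : ℝ → ℝ}

/-- A sequence of nonnegative functions whose modulars are summable is dominated in `L_Ψ`. -/
lemma exists_dominating_of_tsum_lt_top (hΨ : IsYoung Ψ) {R : ℝ} (hR : 0 < R) {c : ℕ → Ω → ℝ}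
    (hc : ∀ j, Measurable (c j)) (hc0 : ∀ j ω, 0 ≤ c j ω)
    (hsum : ∑' j, ∫⁻ ω, ENNReal.ofReal (Ψ (c j ω / R)) ∂P ≠ ⊤) :
    ∃ S : Ω → ℝ, S ∈ Orlicz P Ψ ∧ (∀ ω, 0 ≤ S ω) ∧ ∀ᵐ ω ∂P, ∀ j, c j ω ≤ S ω := by
  set T : Ω → ℝ≥0∞ := fun ω => ∑' j, ENNReal.ofReal (Ψ (c j ω / R)) with hT
  have hTm : Measurable T := Measurable.tsum fun j => hΨ.measurable_comp (hc j) R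
  have hTint : ∫⁻ ω, T ω ∂P ≠ ⊤ := by
    rwa [hT, lintegral_tsum fun j => (hΨ.measurable_comp (hc j) R).aemeasurable]
  have hTfin : ∀ᵐ ω ∂P, T ω < ⊤ := ae_lt_top hTm hTint
  have hle : ∀ j ω, ENNReal.ofReal (Ψ (c j ω / R)) ≤ T ω := fun j ω => ENNReal.le_tsum j
  obtain ⟨M, hM, hMle⟩ := hΨ.exists_abs_le one_pos hR
  have hbdd : ∀ᵐ ω ∂P, BddAbove (range fun j => c j ω) := by
    filter_upwards [hTfin] with ω hω
    refine ⟨M + (T ω).toReal, ?_⟩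
    rintro _ ⟨j, rfl⟩
    have h1 := hMle (c j ω)
    have h2 := (ENNReal.ofReal_le_iff_le_toReal hω.ne).1 (hle j ω)
    have h3 := le_abs_self (c j ω)
    linarith
  refine ⟨fun ω => ⨆ j, c j ω, ⟨Measurable.iSup hc, R⁻¹, inv_pos.2 hR, ?_⟩,
    fun ω => Real.iSup_nonneg fun j => hc0 j ω, ?_⟩
  · refine lt_of_le_of_lt (lintegral_mono_ae ?_) hTint.lt_top
    filter_upwards [hbdd] with ω hω
    have hcl : IsClosed {x : ℝ | ENNReal.ofReal (Ψ (R⁻¹ * x)) ≤ T ω} :=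
      isClosed_le (ENNReal.continuous_ofReal.comp
        (hΨ.continuous.comp (continuous_const.mul continuous_id))) continuous_const
    refine closure_minimal ?_ hcl (csSup_mem_closure (range_nonempty _) hω)
    rintro _ ⟨j, rfl⟩
    simpa only [mem_ofPred_eq, ← div_eq_inv_mul] using hle j ω
  · filter_upwards [hbdd] with ω hω j
    exact le_ciSup hω j

/-- In a modular ball of `L_Ψ`, every sequence that tends to zero almost everywhere has a
subsequence whose Cesàro means are dominated in `L_Ψ`, provided `Ψ (y / n)` is suitably
small compared to `Ψ y`. -/
lemma exists_subseq_cesaro_dominated [IsProbabilityMeasure P] (hΨ : IsYoung Ψ)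
    (hdiv : ∃ (ε : ℕ → ℝ) (K : ℝ), Summable ε ∧ (∀ n, 0 ≤ ε n) ∧ 0 ≤ K ∧
      ∀ (n : ℕ) y, Ψ (y / (n + 1)) ≤ ε n * Ψ y + K)
    {R : ℝ} (hR : 0 < R) {f : ℕ → Ω → ℝ} (hf : ∀ n, f n ∈ modBall P Ψ R)
    (hlim : ∀ᵐ ω ∂P, Tendsto (fun n => f n ω) atTop (𝓝 0)) :
    ∃ φ : ℕ → ℕ, StrictMono φ ∧ ∃ ζ ∈ Orlicz P Ψ, (∀ ω, 0 < ζ ω) ∧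
      ∀ k : ℕ, ∀ᵐ ω ∂P, |(∑ i ∈ Finset.range (k + 1), f (φ i) ω) / (k + 1)| ≤ ζ ω := by
  classical
  obtain ⟨ε, K, hεs, hε0, hK, hεK⟩ := hdiv
  set W : ℕ → Ω → ℝ≥0∞ := fun m ω => ENNReal.ofReal (Ψ (f m ω / R)) + 1 with hWdef
  have hWm : ∀ m, Measurable (W m) := fun m => (hΨ.measurable_comp (hf m).1 R).add_const 1
  have hWfin : ∀ m, ∫⁻ ω, W m ω ∂P ≠ ⊤ := fun m => by
    rw [lintegral_add_right _ measurable_const]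
    exact ENNReal.add_ne_top.2 ⟨((hf m).2.trans_lt ENNReal.one_lt_top).ne, by simp⟩
  set A : ℕ → Set Ω := fun n => {ω | 1 < |f n ω|} with hA
  have hAm : ∀ n, MeasurableSet (A n) := fun n => measurableSet_lt measurable_const (hf n).1.abs
  have hAev : ∀ᵐ ω ∂P, ∀ᶠ n in atTop, ω ∉ A n := by
    filter_upwards [hlim] with ω hω
    have h1 := hω.abs
    rw [abs_zero] at h1
    filter_upwards [h1.eventually (gt_mem_nhds one_pos)] with n hn
    simpa [hA] using hn.le
  obtain ⟨φ, hφ, hφQ⟩ := exists_strictMono_forall_lt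
    (Q := fun i m n => ∫⁻ ω in A n, W m ω ∂P ≤ 2⁻¹ ^ i * 2⁻¹ ^ i)
    (fun i m => (tendsto_setLIntegral_of_eventually_notMem (hWm m) (hWfin m) hAm
        hAev).eventually (ge_mem_nhds (ENNReal.mul_pos (pow_ne_zero _ (by simp))
          (pow_ne_zero _ (by simp)))))
  have hhalf : ∀ i : ℕ, (2⁻¹ : ℝ≥0∞) ^ i ≤ 1 := fun i => pow_le_one₀ (zero_le) (by simp)
  set B : ℕ → Set Ω := fun i => A (φ i) with hB
  have hBm : ∀ i, MeasurableSet (B i) := fun i => hAm _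
  have hPB : ∀ j, P (B j) ≤ 2⁻¹ ^ j := by
    intro j
    rcases Nat.eq_zero_or_pos j with rfl | hj
    · simpa using prob_le_one
    · calc P (B j) = ∫⁻ ω in B j, 1 ∂P := by simp
        _ ≤ ∫⁻ ω in B j, W (φ 0) ω ∂P := lintegral_mono fun ω => le_add_self
        _ ≤ 2⁻¹ ^ j * 2⁻¹ ^ j := hφQ j 0 hj
        _ ≤ 2⁻¹ ^ j * 1 := by gcongr; exact hhalf j
        _ = 2⁻¹ ^ j := mul_one _
  set L : ℕ → Set Ω := fun j => ⋃ i, ⋃ (_ : j < i), B i with hL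
  have hLm : ∀ j, MeasurableSet (L j) := fun j =>
    MeasurableSet.iUnion fun i => MeasurableSet.iUnion fun _ => hBm i
  have hLint : ∀ j, ∫⁻ ω in L j, ENNReal.ofReal (Ψ (f (φ j) ω / R)) ∂P ≤ 2⁻¹ ^ j * 2 := by
    intro j
    calc ∫⁻ ω in L j, ENNReal.ofReal (Ψ (f (φ j) ω / R)) ∂P
        ≤ ∑' i, ∫⁻ ω in ⋃ (_ : j < i), B i, ENNReal.ofReal (Ψ (f (φ j) ω / R)) ∂P :=
          lintegral_iUnion_le _ _
      _ ≤ ∑' i, 2⁻¹ ^ j * 2⁻¹ ^ i := by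
          refine ENNReal.tsum_le_tsum fun i => ?_
          by_cases hi : j < i
          · simp only [hi, iUnion_true]
            calc ∫⁻ ω in B i, ENNReal.ofReal (Ψ (f (φ j) ω / R)) ∂P
                ≤ ∫⁻ ω in B i, W (φ j) ω ∂P := lintegral_mono fun ω => le_self_add
              _ ≤ 2⁻¹ ^ i * 2⁻¹ ^ i := hφQ i j hi
              _ ≤ 2⁻¹ ^ j * 2⁻¹ ^ i :=
                  mul_le_mul_left (pow_le_pow_of_le_one zero_le (by simp) hi.le) _
          · simp [hi]
      _ = 2⁻¹ ^ j * 2 := by rw [ENNReal.tsum_mul_left, ENNReal.tsum_geometric_two]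
  set c : ℕ → Ω → ℝ := fun j => (B j).indicator
    ((L j).piecewise (fun ω => |f (φ j) ω|) (fun ω => |f (φ j) ω| / (j + 1))) with hc
  have hcm : ∀ j, Measurable (c j) := fun j =>
    (Measurable.piecewise (hLm j) (hf _).1.abs ((hf _).1.abs.div_const _)).indicator (hBm j)
  have hc0 : ∀ j ω, 0 ≤ c j ω := by
    intro j ω
    refine indicator_nonneg (fun ω _ => ?_) ω
    by_cases hω : ω ∈ L j
    · rw [piecewise_eq_of_mem _ _ _ hω]; positivity
    · rw [piecewise_eq_of_notMem _ _ _ hω]; positivity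
  have hmod : ∀ j ω, ENNReal.ofReal (Ψ (c j ω / R)) ≤
      (L j).indicator (fun ω => ENNReal.ofReal (Ψ (f (φ j) ω / R))) ω +
        (ENNReal.ofReal (ε j) * ENNReal.ofReal (Ψ (f (φ j) ω / R)) +
          (B j).indicator (fun _ => ENNReal.ofReal K) ω) := by
    intro j ω
    by_cases hB : ω ∈ B j
    · by_cases hω : ω ∈ L j
      · refine le_trans (le_of_eq ?_) le_self_add
        simp only [hc, indicator_of_mem hB, indicator_of_mem hω, piecewise_eq_of_mem _ _ _ hω]
        congr 1
        rw [← hΨ.map_abs (f (φ j) ω / R), abs_div, abs_of_pos hR]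
      · refine le_trans ?_ le_add_self
        simp only [hc, indicator_of_mem hB, piecewise_eq_of_notMem _ _ _ hω]
        rw [← ENNReal.ofReal_mul (hε0 j), ← ENNReal.ofReal_add
          (mul_nonneg (hε0 j) (hΨ.nonneg _)) hK]
        refine ENNReal.ofReal_le_ofReal (le_trans (le_of_eq ?_) (hεK j _))
        rw [← hΨ.map_abs (f (φ j) ω / R / (j + 1)), abs_div, abs_div, abs_of_pos hR,
          abs_of_pos (by positivity : (0 : ℝ) < j + 1)]
        congr 1
        ring
    · simp [hc, indicator_of_notMem hB, hΨ.map_zero]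
  have hmodint : ∀ j, ∫⁻ ω, ENNReal.ofReal (Ψ (c j ω / R)) ∂P ≤
      2⁻¹ ^ j * 2 + (ENNReal.ofReal (ε j) + ENNReal.ofReal K * 2⁻¹ ^ j) := by
    intro j
    refine (lintegral_mono (hmod j)).trans ?_
    have hm := hΨ.measurable_comp (hf (φ j)).1 R
    rw [lintegral_add_left (hm.indicator (hLm j)), lintegral_add_left (hm.const_mul _),
      lintegral_indicator (hLm j), lintegral_const_mul _ hm,
      lintegral_indicator_const (hBm j)]
    gcongr
    · exact hLint j
    · exact (mul_le_mul_right (hf _).2 _).trans (mul_one _).le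
    · exact hPB j
  obtain ⟨S, hS, hS0, hcS⟩ := exists_dominating_of_tsum_lt_top hΨ hR hcm hc0 (by
    refine ((ENNReal.tsum_le_tsum hmodint).trans_lt ?_).ne
    rw [ENNReal.tsum_add, ENNReal.tsum_add, ENNReal.tsum_mul_left, ENNReal.tsum_mul_right,
      ENNReal.tsum_geometric_two, ← ENNReal.ofReal_tsum_of_nonneg hε0 hεs]
    refine ENNReal.add_lt_top.2 ⟨ENNReal.mul_lt_top (by simp) (by simp), ENNReal.add_lt_top.2
      ⟨by simp, ENNReal.mul_lt_top (by simp) (by simp)⟩⟩)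
  refine ⟨φ, hφ, (fun _ => 1) + fun ω => 2 * S ω,
    orlicz_add hΨ (orlicz_const 1) (orlicz_const_mul hS two_pos),
    fun ω => by have := hS0 ω; simp only [Pi.add_apply]; positivity, fun k => ?_⟩
  filter_upwards [hcS] with ω hω
  have hterm : ∀ j, |f (φ j) ω| ≤ (1 + S ω) +
      if ω ∈ B j ∧ ∀ i > j, ω ∉ B i then |f (φ j) ω| else 0 := by
    intro j
    have h0 := hS0 ω
    by_cases hBj : ω ∈ B j
    · by_cases hLj : ω ∈ L j
      · have h1 : |f (φ j) ω| ≤ S ω := by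
          simpa [hc, indicator_of_mem hBj, piecewise_eq_of_mem _ _ _ hLj] using hω j
        have h2 : 0 ≤ if ω ∈ B j ∧ ∀ i > j, ω ∉ B i then |f (φ j) ω| else 0 := by
          split_ifs
          exacts [abs_nonneg _, le_rfl]
        linarith
      · rw [if_pos ⟨hBj, fun i hi hi' => hLj (mem_iUnion₂.2 ⟨i, hi, hi'⟩)⟩]
        linarith
    · rw [if_neg fun h => hBj h.1]
      have : |f (φ j) ω| ≤ 1 := by simpa [hB, hA] using hBj
      linarith
  have hk : (0 : ℝ) < k + 1 := by positivity
  have hlast : ∑ j ∈ Finset.range (k + 1),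
      (if ω ∈ B j ∧ ∀ i > j, ω ∉ B i then |f (φ j) ω| else 0) ≤ (k + 1) * S ω := by
    refine sum_ite_last_le (A := fun j => ω ∈ B j) _ _ (mul_nonneg hk.le (hS0 ω))
      fun j hj hBj hlast => ?_
    have hLj : ω ∉ L j := by
      intro h
      obtain ⟨i, hi, hi'⟩ := mem_iUnion₂.1 h
      exact hlast i hi hi'
    have h1 : |f (φ j) ω| / (j + 1) ≤ S ω := by
      simpa [hc, indicator_of_mem hBj, piecewise_eq_of_notMem _ _ _ hLj] using hω j
    rw [div_le_iff₀ (by positivity), mul_comm] at h1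
    refine h1.trans (mul_le_mul_of_nonneg_right ?_ (hS0 ω))
    have : (j : ℝ) ≤ k := by exact_mod_cast Nat.lt_succ_iff.1 (Finset.mem_range.1 hj)
    linarith
  rw [abs_div, abs_of_pos hk, div_le_iff₀ hk]
  calc |∑ i ∈ Finset.range (k + 1), f (φ i) ω|
      ≤ ∑ i ∈ Finset.range (k + 1), |f (φ i) ω| := Finset.abs_sum_le_sum_abs _ _
    _ ≤ ∑ i ∈ Finset.range (k + 1), ((1 + S ω) +
        if ω ∈ B i ∧ ∀ l > i, ω ∉ B l then |f (φ i) ω| else 0) :=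
        Finset.sum_le_sum fun i _ => hterm i
    _ ≤ (k + 1) * (1 + S ω) + (k + 1) * S ω := by
        rw [Finset.sum_add_distrib]
        simp only [Finset.sum_const, Finset.card_range, nsmul_eq_mul, Nat.cast_add, Nat.cast_one]
        linarith [hlast]
    _ = (1 + 2 * S ω) * (k + 1) := by
        ring

end Cesaro

section Closed

variable {Ω : Type*} [MeasurableSpace Ω] {P : Measure Ω} {Φ : ℝ → ℝ}

/-- A set of functions is boundedly a.e.-closed if it contains the (measurable) almost everywhere
limits of its sequences which lie in a modular ball. -/
def BddAEClosed (P : Measure Ω) (Ψ : ℝ → ℝ) (C : Set (Ω → ℝ)) : Prop :=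
  ∀ r > 0, ∀ (ξ : ℕ → Ω → ℝ) (ξ₀ : Ω → ℝ), (∀ n, ξ n ∈ C) → (∀ n, ξ n ∈ modBall P Ψ r) →
    Measurable ξ₀ → (∀ᵐ ω ∂P, Tendsto (fun n => ξ n ω) atTop (𝓝 (ξ₀ ω))) → ξ₀ ∈ C

lemma bddAEClosed_of_sequentially_closed [IsProbabilityMeasure P] (hΦ : IsYoung Φ)
    (hΔ : Delta2 Φ) {C : Set (Ω → ℝ)} (hC : C ⊆ Orlicz P (conj Φ)) (hconv : Convex ℝ C)
    (hseq : ∀ (ξ : ℕ → Orlicz P (conj Φ)) (ξ₀ : Orlicz P (conj Φ)),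
      (∀ n, ↑(ξ n) ∈ C) →
      Tendsto ξ atTop (@nhds _ (mackeyT P (Orlicz P (conj Φ)) (Orlicz P Φ)) ξ₀) →
      ↑ξ₀ ∈ C) : BddAEClosed P (conj Φ) C := by
  intro r hr ξ ξ₀ hξC hξ hm hlim
  have hΨ := hΦ.conj_isYoung
  have hξ₀ := modBall_of_tendsto_ae hΨ hξ hm hlim
  have hlim0 : ∀ᵐ ω ∂P, Tendsto (fun n => (ξ n - ξ₀) ω) atTop (𝓝 0) := by
    filter_upwards [hlim] with ω hω
    simpa using hω.sub_const (ξ₀ ω)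
  obtain ⟨φ, hφ, ζ, hζ, hζ0, hdom⟩ := exists_subseq_cesaro_dominated hΨ
    (hΦ.exists_conj_div_le hΔ) (R := 2 * r) (by positivity)
    (fun n => sub_mem_modBall hΨ (hξ n) hξ₀) hlim0
  set c : ℕ → Ω → ℝ := fun k => ∑ i ∈ Finset.range (k + 1), ((k : ℝ) + 1)⁻¹ • ξ (φ i) with hc
  have hcC : ∀ k, c k ∈ C := fun k =>
    hconv.sum_mem (fun i _ => by positivity) (by
      simp only [Finset.sum_const, Finset.card_range, nsmul_eq_mul, Nat.cast_add, Nat.cast_one]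
      field_simp) fun i _ => hξC _
  have hcω : ∀ k ω, c k ω - ξ₀ ω =
      (∑ i ∈ Finset.range (k + 1), (ξ (φ i) - ξ₀) ω) / (k + 1) := by
    intro k ω
    simp only [hc, Finset.sum_apply, Pi.smul_apply, smul_eq_mul, Pi.sub_apply,
      Finset.sum_sub_distrib, Finset.sum_const, Finset.card_range, nsmul_eq_mul, Nat.cast_add,
      Nat.cast_one, ← Finset.mul_sum]
    field_simp
  refine hseq (fun k => ⟨c k, hC (hcC k)⟩) ⟨ξ₀, mem_orlicz_of_mem_modBall hr hξ₀⟩ hcC ?_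
  refine tendsto_mackeyT_of_dominated hΦ hζ hζ0 (fun k => ?_) ?_
  · filter_upwards [hdom k] with ω hω
    rw [hcω]
    exact hω
  · filter_upwards [hlim0] with ω hω
    have h1 := ((hω.comp hφ.tendsto_atTop).cesaro).comp (tendsto_add_atTop_nat 1)
    have h2 := h1.add_const (ξ₀ ω)
    rw [zero_add] at h2
    refine h2.congr fun k => ?_
    have := hcω k ω
    simp only [Function.comp_apply, Nat.cast_add, Nat.cast_one]
    rw [← div_eq_inv_mul, ← this]
    ring

end Closed

section Minimizing

variable {Ω : Type*} [MeasurableSpace Ω] {P : Measure Ω} {Ψ : ℝ → ℝ}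

/-- A smooth strictly convex function of linear growth. -/
def hyp (x : ℝ) : ℝ := √(1 + x ^ 2)

/-- The derivative of `hyp`. -/
def hypDeriv (x : ℝ) : ℝ := x / hyp x

lemma hyp_sq (x : ℝ) : hyp x ^ 2 = 1 + x ^ 2 := Real.sq_sqrt (by positivity)

lemma hyp_pos (x : ℝ) : 0 < hyp x := Real.sqrt_pos.2 (by positivity)

lemma abs_le_hyp (x : ℝ) : |x| ≤ hyp x := Real.abs_le_sqrt (by linarith)

lemma continuous_hyp : Continuous hyp := by unfold hyp; fun_prop

lemma continuous_hypDeriv : Continuous hypDeriv :=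
  continuous_id.div continuous_hyp fun x => (hyp_pos x).ne'

lemma abs_hypDeriv_le (x : ℝ) : |hypDeriv x| ≤ 1 := by
  rw [hypDeriv, abs_div, abs_of_pos (hyp_pos x), div_le_one (hyp_pos x)]
  exact abs_le_hyp x

lemma one_add_mul_le_hyp_mul (x y : ℝ) : 1 + x * y ≤ hyp x * hyp y := by
  refine le_of_sq_le_sq ?_ (mul_pos (hyp_pos x) (hyp_pos y)).le
  rw [mul_pow, hyp_sq, hyp_sq]
  nlinarith [sq_nonneg (x - y)]

lemma hyp_sub_le (x y : ℝ) : hyp y - hyp x ≤ hypDeriv y * (y - x) := by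
  rw [hypDeriv, div_mul_eq_mul_div, le_div_iff₀ (hyp_pos y)]
  nlinarith [one_add_mul_le_hyp_mul x y, hyp_sq y]

lemma abs_hyp_sub_le (x y : ℝ) : |hyp y - hyp x| ≤ |y - x| := by
  have key : ∀ x y, hyp y - hyp x ≤ |y - x| := fun x y => by
    refine (hyp_sub_le x y).trans ((le_abs_self _).trans ?_)
    rw [abs_mul]
    exact mul_le_of_le_one_left (abs_nonneg _) (abs_hypDeriv_le y)
  exact abs_sub_le_iff.2 ⟨key x y, abs_sub_comm x y ▸ key y x⟩

lemma convexOn_hyp : ConvexOn ℝ univ hyp := by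
  refine ⟨convex_univ, fun x _ y _ a b ha hb hab => ?_⟩
  set z := a • x + b • y with hz
  have h1 := mul_le_mul_of_nonneg_left (hyp_sub_le x z) ha
  have h2 := mul_le_mul_of_nonneg_left (hyp_sub_le y z) hb
  have h3 : a * (hypDeriv z * (z - x)) + b * (hypDeriv z * (z - y)) = 0 := by
    have : a * (z - x) + b * (z - y) = 0 := by
      rw [hz, smul_eq_mul, smul_eq_mul]
      linear_combination (a * x + b * y) * hab
    linear_combination hypDeriv z * this
  have h4 : (a + b) * hyp z = hyp z := by rw [hab, one_mul]
  simp only [smul_eq_mul]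
  nlinarith

lemma sub_sq_le_hyp {N x y : ℝ} (hx : |x| ≤ N) (hy : |y| ≤ N) :
    (x - y) ^ 2 ≤ 4 * (1 + N) ^ 3 * (hyp x + hyp y - 2 * hyp ((x + y) / 2)) := by
  have hN : 0 ≤ N := (abs_nonneg x).trans hx
  have hb : ∀ {x}, |x| ≤ N → hyp x ≤ 1 + N := fun {x} hx =>
    Real.sqrt_le_iff.2 ⟨by positivity, by nlinarith [sq_abs x, abs_nonneg x]⟩
  have hp := hb hx
  have hq := hb hy
  set p := hyp x
  set q := hyp y
  set s := 2 * hyp ((x + y) / 2) with hs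
  have hp0 : 0 < p := hyp_pos x
  have hq0 : 0 < q := hyp_pos y
  have hs0 : 0 < s := by have := hyp_pos ((x + y) / 2); positivity
  have hp2 : p ^ 2 = 1 + x ^ 2 := hyp_sq x
  have hq2 : q ^ 2 = 1 + y ^ 2 := hyp_sq y
  have hs2 : s ^ 2 = 4 + (x + y) ^ 2 := by rw [hs, mul_pow, hyp_sq]; ring
  have hpq : 1 + x * y ≤ p * q := one_add_mul_le_hyp_mul x y
  have h1 : (p + q - s) * (p + q + s) = 2 * (p * q - (1 + x * y)) := by
    linear_combination hp2 + hq2 - hs2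
  have h2 : (x - y) ^ 2 = (p * q - (1 + x * y)) * (p * q + (1 + x * y)) := by
    have : (p * q) ^ 2 = (1 + x ^ 2) * (1 + y ^ 2) := by rw [mul_pow, hp2, hq2]
    linear_combination -this
  have hd : 0 ≤ p + q - s := by
    by_contra h
    push Not at h
    nlinarith [mul_neg_of_neg_of_pos h (by positivity : 0 < p + q + s)]
  have h3 : p * q - (1 + x * y) ≤ (p + q - s) * (p + q) := by nlinarith
  have h4 : p * q + (1 + x * y) ≤ 2 * (1 + N) ^ 2 := by
    have := mul_le_mul hp hq hq0.le (by positivity)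
    nlinarith
  calc (x - y) ^ 2 ≤ (p * q - (1 + x * y)) * (2 * (1 + N) ^ 2) := by
        rw [h2]; exact mul_le_mul_of_nonneg_left h4 (by linarith)
    _ ≤ (p + q - s) * (p + q) * (2 * (1 + N) ^ 2) := by gcongr
    _ ≤ (p + q - s) * (2 * (1 + N)) * (2 * (1 + N) ^ 2) := by gcongr; linarith
    _ = 4 * (1 + N) ^ 3 * (p + q - s) := by ring

lemma exists_abs_sub_le_hyp (hΨ : IsYoung Ψ) {r ε : ℝ} (hr : 0 < r) (hε : 0 < ε) :
    ∃ K : ℝ, 0 ≤ K ∧ ∀ x y, |x - y| ≤ ε + ε * (Ψ (x / r) + Ψ (y / r)) +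
      K * (hyp x + hyp y - 2 * hyp ((x + y) / 2)) := by
  obtain ⟨M, hM, h⟩ := hΨ.exists_abs_le (show 0 < ε / 4 by positivity) hr
  refine ⟨4 * (1 + 2 * M) ^ 3 / ε, by positivity, fun x y => ?_⟩
  have hd : 0 ≤ hyp x + hyp y - 2 * hyp ((x + y) / 2) := by
    have := convexOn_hyp.2 (mem_univ x) (mem_univ y) (show (0 : ℝ) ≤ 1 / 2 by norm_num)
      (show (0 : ℝ) ≤ 1 / 2 by norm_num) (by norm_num)
    simp only [smul_eq_mul] at this
    rw [show 1 / 2 * x + 1 / 2 * y = (x + y) / 2 by ring] at this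
    linarith
  have hx := hΨ.nonneg (x / r)
  have hy := hΨ.nonneg (y / r)
  have hK : 0 ≤ 4 * (1 + 2 * M) ^ 3 / ε * (hyp x + hyp y - 2 * hyp ((x + y) / 2)) := by
    positivity
  have hxy := abs_sub x y
  by_cases hb : |x| ≤ 2 * M ∧ |y| ≤ 2 * M
  · have h1 := sub_sq_le_hyp hb.1 hb.2
    have h2 : |x - y| ≤ ε + (x - y) ^ 2 / ε := by
      rw [← sq_abs, ← sub_nonneg]
      have : ε + |x - y| ^ 2 / ε - |x - y| = ((|x - y| - ε / 2) ^ 2 + 3 * ε ^ 2 / 4) / ε := by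
        field_simp; ring
      rw [this]
      positivity
    have h3 := div_le_div_of_nonneg_right h1 hε.le
    rw [mul_div_right_comm] at h3
    nlinarith
  · have hx' := h x
    have hy' := h y
    rcases le_total |x| |y| with hle | hle
    · have : 2 * M < |y| := by
        by_contra hcon
        exact hb ⟨hle.trans (not_lt.1 hcon), not_lt.1 hcon⟩
      nlinarith [mul_nonneg hε.le hx]
    · have : 2 * M < |x| := by
        by_contra hcon
        exact hb ⟨not_lt.1 hcon, hle.trans (not_lt.1 hcon)⟩
      nlinarith [mul_nonneg hε.le hy]

end Minimizing

section Minimizing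

variable {Ω : Type*} [MeasurableSpace Ω] {P : Measure Ω} {Ψ : ℝ → ℝ}

lemma exists_subseq_tendsto_ae_of_cauchy {w : ℕ → Ω → ℝ} (hw : ∀ n, Integrable (w n) P)
    (hcau : ∀ ε > 0, ∃ N : ℕ, ∀ n ≥ N, ∀ m ≥ n, ∫ ω, |w m ω - w n ω| ∂P < ε) :
    ∃ φ : ℕ → ℕ, StrictMono φ ∧ ∃ g : Ω → ℝ, Measurable g ∧
      ∀ᵐ ω ∂P, Tendsto (fun n => w (φ n) ω) atTop (𝓝 (g ω)) := by
  have hc : CauchySeq fun n => (hw n).toL1 (w n) := by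
    rw [Metric.cauchySeq_iff']
    intro ε hε
    obtain ⟨N, hN⟩ := hcau ε hε
    refine ⟨N, fun m hm => ?_⟩
    rw [dist_eq_norm, ← Integrable.toL1_sub _ _ (hw m) (hw N),
      L1.norm_of_fun_eq_integral_norm]
    exact hN N le_rfl m hm
  obtain ⟨G, hG⟩ := cauchySeq_tendsto_of_complete hc
  obtain ⟨φ, hφ, hφG⟩ := (tendstoInMeasure_of_tendsto_Lp hG).exists_seq_tendsto_ae
  have hGm := (Lp.aestronglyMeasurable G).aemeasurable
  refine ⟨φ, hφ, hGm.mk G, hGm.measurable_mk, ?_⟩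
  filter_upwards [hφG, hGm.ae_eq_mk, ae_all_iff.2 fun n => (hw n).coeFn_toL1] with ω h1 h2 h3
  rw [← h2]
  exact h1.congr fun n => h3 (φ n)

variable [IsProbabilityMeasure P]

lemma integrable_hyp {w : Ω → ℝ} (hw : Integrable w P) : Integrable (fun ω => hyp (w ω)) P := by
  refine Integrable.mono' ((integrable_const (1 : ℝ)).add hw.abs)
    (continuous_hyp.comp_aestronglyMeasurable hw.aestronglyMeasurable)
    (Eventually.of_forall fun ω => ?_)
  have h := abs_hyp_sub_le 0 (w ω)
  have h0 : hyp 0 = 1 := by simp [hyp]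
  rw [h0, sub_zero] at h
  rw [Real.norm_eq_abs, abs_of_pos (hyp_pos _)]
  have := (le_abs_self _).trans h
  simp only [Pi.add_apply]
  linarith

lemma exists_integral_abs_sub_le_hyp (hΨ : IsYoung Ψ) {r ε : ℝ} (hr : 0 < r) (hε : 0 < ε) :
    ∃ K : ℝ, 0 ≤ K ∧ ∀ x ∈ modBall P Ψ r, ∀ y ∈ modBall P Ψ r,
      ∫ ω, |x ω - y ω| ∂P ≤ ε + K * (∫ ω, hyp (x ω) ∂P + ∫ ω, hyp (y ω) ∂P -
        2 * ∫ ω, hyp ((x ω + y ω) / 2) ∂P) := by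
  obtain ⟨K, hK, h⟩ := exists_abs_sub_le_hyp hΨ hr (show 0 < ε / 3 by positivity)
  refine ⟨K, hK, fun x hx y hy => ?_⟩
  have ix := integrable_of_mem_modBall hΨ hr hx
  have iy := integrable_of_mem_modBall hΨ hr hy
  have mx := integrable_modular hΨ hx
  have my := integrable_modular hΨ hy
  have jx := integrable_hyp ix
  have jy := integrable_hyp iy
  have jm := integrable_hyp ((ix.add iy).div_const 2)
  simp only [Pi.add_apply] at jm
  have js : Integrable (fun ω => hyp (x ω) + hyp (y ω)) P := jx.add jy
  have i1 : Integrable (fun ω => ε / 3 * (Ψ (x ω / r) + Ψ (y ω / r))) P :=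
    (mx.1.add my.1).const_mul (ε / 3)
  have i2 : Integrable (fun ω => K * (hyp (x ω) + hyp (y ω) - 2 * hyp ((x ω + y ω) / 2))) P :=
    (js.sub (jm.const_mul 2)).const_mul K
  have i3 : Integrable (fun ω => ε / 3 + ε / 3 * (Ψ (x ω / r) + Ψ (y ω / r))) P :=
    (integrable_const (ε / 3)).add i1
  calc ∫ ω, |x ω - y ω| ∂P
      ≤ ∫ ω, (ε / 3 + ε / 3 * (Ψ (x ω / r) + Ψ (y ω / r)) +
          K * (hyp (x ω) + hyp (y ω) - 2 * hyp ((x ω + y ω) / 2))) ∂P :=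
        integral_mono (ix.sub iy).abs (i3.add i2)
          fun ω => h (x ω) (y ω)
    _ = ε / 3 + ε / 3 * (∫ ω, Ψ (x ω / r) ∂P + ∫ ω, Ψ (y ω / r) ∂P) +
          K * (∫ ω, hyp (x ω) ∂P + ∫ ω, hyp (y ω) ∂P - 2 * ∫ ω, hyp ((x ω + y ω) / 2) ∂P) := by
        rw [integral_add i3 i2,
          integral_add (integrable_const (ε / 3)) i1, integral_const_mul, integral_const_mul,
          integral_add mx.1 my.1, integral_sub js (jm.const_mul 2), integral_add jx jy,
          integral_const_mul]
        simp
    _ ≤ _ := by nlinarith [mx.2, my.2]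

/-- Sequences which approximately minimize the strictly convex functional `∫ hyp` over a decreasing
sequence of convex subsets of a modular ball converge almost everywhere along a subsequence. -/
lemma exists_subseq_tendsto_ae_of_minimizing (hΨ : IsYoung Ψ) {r : ℝ} (hr : 0 < r)
    {S : ℕ → Set (Ω → ℝ)} (hS : Antitone S) (hconv : ∀ n, Convex ℝ (S n))
    (hball : ∀ n, S n ⊆ modBall P Ψ r) {w : ℕ → Ω → ℝ} (hw : ∀ n, w n ∈ S n)
    (hmin : ∀ (n : ℕ), ∀ v ∈ S n, ∫ ω, hyp (w n ω) ∂P ≤ ∫ ω, hyp (v ω) ∂P + 1 / (n + 1)) :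
    ∃ φ : ℕ → ℕ, StrictMono φ ∧ ∃ g : Ω → ℝ, Measurable g ∧
      ∀ᵐ ω ∂P, Tendsto (fun n => w (φ n) ω) atTop (𝓝 (g ω)) := by
  have hwb : ∀ n, w n ∈ modBall P Ψ r := fun n => hball n (hw n)
  refine exists_subseq_tendsto_ae_of_cauchy (fun n => integrable_of_mem_modBall hΨ hr (hwb n)) ?_
  set c : ℕ → ℝ := fun n => sInf ((fun v : Ω → ℝ => ∫ ω, hyp (v ω) ∂P) '' S n) with hc
  have hbelow : ∀ n, BddBelow ((fun v : Ω → ℝ => ∫ ω, hyp (v ω) ∂P) '' S n) := fun n =>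
    ⟨0, by rintro _ ⟨v, -, rfl⟩; exact integral_nonneg fun ω => (hyp_pos _).le⟩
  have hcle : ∀ n, ∀ v ∈ S n, c n ≤ ∫ ω, hyp (v ω) ∂P := fun n v hv =>
    csInf_le (hbelow n) ⟨v, hv, rfl⟩
  have hwc : ∀ n, ∫ ω, hyp (w n ω) ∂P ≤ c n + 1 / (n + 1) := fun n => by
    rw [← sub_le_iff_le_add]
    refine le_csInf ⟨_, w n, hw n, rfl⟩ ?_
    rintro _ ⟨v, hv, rfl⟩
    linarith [hmin n v hv]
  have hcmono : Monotone c := fun n m hnm =>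
    csInf_le_csInf (hbelow n) ⟨_, w m, hw m, rfl⟩ (image_mono (hS hnm))
  obtain ⟨M, hM⟩ := exists_integral_abs_le (P := P) hΨ hr
  have hbdd : BddAbove (range c) := by
    refine ⟨1 + M, ?_⟩
    rintro _ ⟨n, rfl⟩
    refine (hcle n _ (hw n)).trans ?_
    have hi := integrable_of_mem_modBall hΨ hr (hwb n)
    have h1 : ∫ ω, hyp (w n ω) ∂P ≤ ∫ ω, (1 + |w n ω|) ∂P := by
      refine integral_mono (integrable_hyp hi) ((integrable_const _).add hi.abs) fun ω => ?_
      have h := (le_abs_self _).trans (abs_hyp_sub_le 0 (w n ω))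
      rw [sub_zero, show hyp 0 = 1 by simp [hyp]] at h
      dsimp only
      linarith
    rw [integral_add (integrable_const _) hi.abs] at h1
    have := hM _ (hwb n)
    simp at h1
    linarith
  have hlim := tendsto_atTop_ciSup hcmono hbdd
  intro ε hε
  obtain ⟨K, hK, hKle⟩ := exists_integral_abs_sub_le_hyp (P := P) hΨ hr (half_pos hε)
  have hev : Tendsto (fun n : ℕ => K * ((⨆ i, c i) - c n + 2 * (1 / ((n : ℝ) + 1)))) atTop
      (𝓝 (K * ((⨆ i, c i) - (⨆ i, c i) + 2 * 0))) :=
    ((tendsto_const_nhds.sub hlim).add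
      (tendsto_one_div_add_atTop_nhds_zero_nat.const_mul 2)).const_mul K
  rw [sub_self, mul_zero, add_zero, mul_zero] at hev
  obtain ⟨N, hN⟩ := eventually_atTop.1 (hev.eventually (gt_mem_nhds (half_pos hε)))
  refine ⟨N, fun n hn m hm => ?_⟩
  have hmid : (fun ω => (w m ω + w n ω) / 2) ∈ S n := by
    have := hconv n (hS hm (hw m)) (hw n) (show (0 : ℝ) ≤ 1 / 2 by norm_num)
      (show (0 : ℝ) ≤ 1 / 2 by norm_num) (by norm_num)
    convert this using 1
    funext ω
    simp only [Pi.add_apply, Pi.smul_apply, smul_eq_mul]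
    ring
  have h1 := hKle _ (hwb m) _ (hwb n)
  have h2 := hcle n _ hmid
  have h3 := hwc m
  have h4 := hwc n
  have h5 : (1 : ℝ) / (m + 1) ≤ 1 / (n + 1) :=
    one_div_le_one_div_of_le (by positivity) (by exact_mod_cast Nat.succ_le_succ hm)
  have h6 : c m ≤ ⨆ i, c i := le_ciSup hbdd m
  have h7 : ∫ ω, hyp (w m ω) ∂P + ∫ ω, hyp (w n ω) ∂P -
      2 * ∫ ω, hyp ((w m ω + w n ω) / 2) ∂P ≤ (⨆ i, c i) - c n + 2 * (1 / ((n : ℝ) + 1)) := by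
    linarith
  have h8 := mul_le_mul_of_nonneg_left h7 hK
  have h9 := hN n hn
  linarith

end Minimizing

section Separation

open scoped Pointwise

variable {Ω : Type*} [MeasurableSpace Ω]

lemma exists_minimizing_seq {P : Measure Ω} {S : ℕ → Set (Ω → ℝ)} (hne : ∀ n, (S n).Nonempty) :
    ∃ w : ℕ → Ω → ℝ, (∀ n, w n ∈ S n) ∧
      ∀ (n : ℕ), ∀ v ∈ S n, ∫ ω, hyp (w n ω) ∂P ≤ ∫ ω, hyp (v ω) ∂P + 1 / (n + 1) := by
  have : ∀ n : ℕ, ∃ w ∈ S n, ∀ v ∈ S n,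
      ∫ ω, hyp (w ω) ∂P ≤ ∫ ω, hyp (v ω) ∂P + 1 / ((n : ℝ) + 1) := by
    intro n
    have hb : BddBelow ((fun v : Ω → ℝ => ∫ ω, hyp (v ω) ∂P) '' S n) :=
      ⟨0, by rintro _ ⟨v, -, rfl⟩; exact integral_nonneg fun ω => (hyp_pos _).le⟩
    obtain ⟨_, ⟨w, hw, rfl⟩, hlt⟩ := Real.lt_sInf_add_pos ((hne n).image _)
      (show (0 : ℝ) < 1 / ((n : ℝ) + 1) by positivity)
    exact ⟨w, hw, fun v hv => hlt.le.trans (by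
      have := csInf_le hb ⟨v, hv, rfl⟩
      linarith)⟩
  choose w hw hmin using this
  exact ⟨w, hw, hmin⟩

variable {P : Measure Ω} [IsProbabilityMeasure P] {Ψ : ℝ → ℝ}

lemma integral_hyp_convex {u v : Ω → ℝ} (hu : Integrable u P) (hv : Integrable v P) {a b : ℝ}
    (ha : 0 ≤ a) (hb : 0 ≤ b) (hab : a + b = 1) :
    ∫ ω, hyp ((a • u + b • v) ω) ∂P ≤ a * ∫ ω, hyp (u ω) ∂P + b * ∫ ω, hyp (v ω) ∂P := by
  rw [← integral_const_mul, ← integral_const_mul,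
    ← integral_add ((integrable_hyp hu).const_mul a) ((integrable_hyp hv).const_mul b)]
  exact integral_mono (integrable_hyp ((hu.smul a).add (hv.smul b)))
    (((integrable_hyp hu).const_mul a).add ((integrable_hyp hv).const_mul b))
    fun ω => convexOn_hyp.2 (mem_univ (u ω)) (mem_univ (v ω)) ha hb hab

/-- The functional `∫ hyp` attains its minimum on the difference of two boundedly a.e.-closed convex
subsets of a modular ball. -/
lemma exists_sub_minimizer (hΨ : IsYoung Ψ) {R : ℝ} (hR : 0 < R) {X Y : Set (Ω → ℝ)}
    (hX : X ⊆ modBall P Ψ R) (hY : Y ⊆ modBall P Ψ R) (hXc : Convex ℝ X) (hYc : Convex ℝ Y)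
    (hXcl : BddAEClosed P Ψ X) (hYcl : BddAEClosed P Ψ Y) (hXn : X.Nonempty) (hYn : Y.Nonempty) :
    ∃ a ∈ X, ∃ b ∈ Y, ∀ a' ∈ X, ∀ b' ∈ Y,
      ∫ ω, hyp ((a - b) ω) ∂P ≤ ∫ ω, hyp ((a' - b') ω) ∂P := by
  have h2R : 0 < 2 * R := by positivity
  have hInt : ∀ a ∈ X, ∀ b ∈ Y, Integrable (a - b) P := fun a ha b hb =>
    (integrable_of_mem_modBall hΨ hR (hX ha)).sub (integrable_of_mem_modBall hΨ hR (hY hb))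
  set V : Set ℝ := {t | ∃ a ∈ X, ∃ b ∈ Y, t = ∫ ω, hyp ((a - b) ω) ∂P} with hV
  have hVn : V.Nonempty := by
    obtain ⟨a, ha⟩ := hXn
    obtain ⟨b, hb⟩ := hYn
    exact ⟨_, a, ha, b, hb, rfl⟩
  have hVb : BddBelow V :=
    ⟨0, by rintro _ ⟨a, -, b, -, rfl⟩; exact integral_nonneg fun ω => (hyp_pos _).le⟩
  have hinf : ∀ a ∈ X, ∀ b ∈ Y, sInf V ≤ ∫ ω, hyp ((a - b) ω) ∂P := fun a ha b hb =>
    csInf_le hVb ⟨a, ha, b, hb, rfl⟩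
  set S : ℕ → Set (Ω → ℝ) := fun n =>
    {a ∈ X | ∃ b ∈ Y, ∫ ω, hyp ((a - b) ω) ∂P ≤ sInf V + 1 / ((n : ℝ) + 1)} with hS
  have hSanti : Antitone S := by
    rintro n m hnm a ⟨ha, b, hb, hle⟩
    refine ⟨ha, b, hb, hle.trans ?_⟩
    gcongr
  have hSconv : ∀ n, Convex ℝ (S n) := by
    rintro n a ⟨ha, b, hb, hle⟩ a' ⟨ha', b', hb', hle'⟩ s t hs ht hst
    refine ⟨hXc ha ha' hs ht hst, s • b + t • b', hYc hb hb' hs ht hst, ?_⟩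
    have h := integral_hyp_convex (hInt a ha b hb) (hInt a' ha' b' hb') hs ht hst
    rw [show s • (a - b) + t • (a' - b') = s • a + t • a' - (s • b + t • b') by
      simp only [smul_sub]; abel] at h
    have h1 := mul_le_mul_of_nonneg_left hle hs
    have h2 := mul_le_mul_of_nonneg_left hle' ht
    have h3 : (s + t) * (sInf V + 1 / ((n : ℝ) + 1)) = sInf V + 1 / ((n : ℝ) + 1) := by
      rw [hst, one_mul]
    linarith
  have hSne : ∀ n, (S n).Nonempty := by
    intro n
    obtain ⟨_, ⟨a, ha, b, hb, rfl⟩, hlt⟩ := Real.lt_sInf_add_pos hVn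
      (show (0 : ℝ) < 1 / ((n : ℝ) + 1) by positivity)
    exact ⟨a, ha, b, hb, hlt.le⟩
  obtain ⟨a, haS, hamin⟩ := exists_minimizing_seq (P := P) hSne
  obtain ⟨φ, hφ, g, hg, hφg⟩ := exists_subseq_tendsto_ae_of_minimizing hΨ hR hSanti hSconv
    (fun n => (fun x hx => hX hx.1)) haS hamin
  have haX : ∀ n, a n ∈ X := fun n => (haS n).1
  choose b hbY hble using fun n => (haS n).2
  have hball : ∀ n, a n - b n ∈ modBall P Ψ (2 * R) := fun n =>
    sub_mem_modBall hΨ (hX (haX n)) (hY (hbY n))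
  have hφn : ∀ (n : ℕ), (1 : ℝ) / (φ n + 1) ≤ 1 / (n + 1) := fun n =>
    one_div_le_one_div_of_le (by positivity) (by exact_mod_cast Nat.succ_le_succ (hφ.id_le n))
  obtain ⟨ψ, hψ, w, hw, hψw⟩ := exists_subseq_tendsto_ae_of_minimizing hΨ h2R
    (S := fun _ => X - Y) antitone_const (fun _ => hXc.sub hYc)
    (fun _ => by rintro _ ⟨x, hx, y, hy, rfl⟩; exact sub_mem_modBall hΨ (hX hx) (hY hy))
    (w := fun n => a (φ n) - b (φ n)) (fun n => sub_mem_sub (haX _) (hbY _))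
    (by
      rintro n _ ⟨x, hx, y, hy, rfl⟩
      linarith [hble (φ n), hφn n, hinf x hx y hy])
  have hga : ∀ᵐ ω ∂P, Tendsto (fun n => a (φ (ψ n)) ω) atTop (𝓝 (g ω)) := by
    filter_upwards [hφg] with ω hω
    exact hω.comp hψ.tendsto_atTop
  have hgX : g ∈ X := hXcl R hR _ g (fun n => haX _) (fun n => hX (haX _)) hg hga
  have hgY : g - w ∈ Y := by
    refine hYcl R hR (fun n => b (φ (ψ n))) (g - w) (fun n => hbY _) (fun n => hY (hbY _))
      (hg.sub hw) ?_
    filter_upwards [hga, hψw] with ω h1 h2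
    exact (h1.sub h2).congr fun n => by simp
  have hwball : w ∈ modBall P Ψ (2 * R) := modBall_of_tendsto_ae hΨ (fun n => hball _) hw hψw
  refine ⟨g, hgX, g - w, hgY, fun a' ha' b' hb' => le_trans ?_ (hinf a' ha' b' hb')⟩
  rw [sub_sub_cancel]
  have hL1 := tendsto_integral_abs_sub hΨ h2R (fun n => hball (φ (ψ n))) hwball hψw
  have h0 := (tendsto_one_div_add_atTop_nhds_zero_nat (𝕜 := ℝ)).comp (hφ.comp hψ).tendsto_atTop
  have hlim := (hL1.add h0).const_add (sInf V)
  rw [add_zero, add_zero] at hlim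
  refine ge_of_tendsto' hlim fun n => ?_
  have hwi := integrable_of_mem_modBall hΨ h2R hwball
  have hni := integrable_of_mem_modBall hΨ h2R (hball (φ (ψ n)))
  have hdi : Integrable (fun ω => |(a (φ (ψ n)) - b (φ (ψ n))) ω - w ω|) P := (hni.sub hwi).abs
  have h1 : ∫ ω, hyp (w ω) ∂P ≤
      ∫ ω, (hyp ((a (φ (ψ n)) - b (φ (ψ n))) ω) + |(a (φ (ψ n)) - b (φ (ψ n))) ω - w ω|) ∂P := by
    refine integral_mono (integrable_hyp hwi) ((integrable_hyp hni).add hdi)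
      fun ω => ?_
    have := (abs_le.1 (abs_hyp_sub_le (w ω) ((a (φ (ψ n)) - b (φ (ψ n))) ω))).1
    dsimp only
    linarith
  rw [integral_add (integrable_hyp hni) hdi] at h1
  have h2 := hble (φ (ψ n))
  simp only [Function.comp_apply]
  linarith

/-- Separation of disjoint boundedly a.e.-closed convex subsets of a modular ball by a bounded
function. -/
lemma exists_separating (hΨ : IsYoung Ψ) {R : ℝ} (hR : 0 < R) {X Y : Set (Ω → ℝ)}
    (hX : X ⊆ modBall P Ψ R) (hY : Y ⊆ modBall P Ψ R) (hXc : Convex ℝ X) (hYc : Convex ℝ Y)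
    (hXcl : BddAEClosed P Ψ X) (hYcl : BddAEClosed P Ψ Y) (hXn : X.Nonempty) (hYn : Y.Nonempty)
    (hdisj : Disjoint X Y) :
    ∃ η : Ω → ℝ, Measurable η ∧ (∀ ω, |η ω| ≤ 1) ∧ ∃ κ > 0, ∀ a ∈ X, ∀ b ∈ Y,
      κ ≤ pairing P a η - pairing P b η := by
  obtain ⟨a, ha, b, hb, hmin⟩ := exists_sub_minimizer hΨ hR hX hY hXc hYc hXcl hYcl hXn hYn
  have hi : ∀ {u}, u ∈ modBall P Ψ R → Integrable u P := integrable_of_mem_modBall hΨ hR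
  set w := a - b with hw
  have hwm : Measurable w := (hX ha).1.sub (hY hb).1
  have hwi : Integrable w P := (hi (hX ha)).sub (hi (hY hb))
  set η : Ω → ℝ := fun ω => hypDeriv (w ω) with hη
  have hηm : Measurable η := continuous_hypDeriv.measurable.comp hwm
  have hη1 : ∀ ω, |η ω| ≤ 1 := fun ω => abs_hypDeriv_le _
  have hmulη : ∀ {u}, Integrable u P → Integrable (fun ω => u ω * η ω) P := fun hu =>
    hu.mul_bdd hηm.aestronglyMeasurable (Eventually.of_forall hη1)
  have hww : ∀ ω, w ω * η ω = w ω ^ 2 / hyp (w ω) := fun ω => by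
    simp only [hη, hypDeriv]; ring
  have hww0 : ∀ ω, 0 ≤ w ω * η ω := fun ω => by
    rw [hww]; have := hyp_pos (w ω); positivity
  refine ⟨η, hηm, hη1, ∫ ω, w ω * η ω ∂P, ?_, fun a' ha' b' hb' => ?_⟩
  · refine lt_of_le_of_ne (integral_nonneg hww0) fun h => ?_
    rw [eq_comm, integral_eq_zero_iff_of_nonneg hww0 (hmulη hwi)] at h
    refine disjoint_left.1 hdisj ha (hYcl R hR (fun _ => b) a (fun _ => hb) (fun _ => hY hb)
      (hX ha).1 ?_)
    filter_upwards [h] with ω hω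
    have h1 : w ω = 0 := by
      simp only [Pi.zero_apply] at hω
      rw [hww, div_eq_zero_iff, or_iff_left (hyp_pos _).ne'] at hω
      exact pow_eq_zero_iff two_ne_zero |>.1 hω
    have h2 : b ω = a ω := by
      rw [hw, Pi.sub_apply] at h1
      linarith
    rw [h2]
    exact tendsto_const_nhds
  · set v := a' - b' with hv
    have hvi : Integrable v P := (hi (hX ha')).sub (hi (hY hb'))
    have hvm : Measurable v := (hX ha').1.sub (hY hb').1
    set t : ℕ → ℝ := fun n => 1 / ((n : ℝ) + 1) with ht
    have ht0 : ∀ n, 0 < t n := fun n => by simp only [ht]; positivity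
    have ht1 : ∀ n, t n ≤ 1 := fun n => by
      simp only [ht]
      rw [div_le_one (by positivity)]
      linarith [Nat.cast_nonneg (α := ℝ) n]
    set z : ℕ → Ω → ℝ := fun n ω => w ω + t n * (v ω - w ω) with hz
    have hzm : ∀ n, Measurable (z n) := fun n => hwm.add ((hvm.sub hwm).const_mul _)
    have hzi : ∀ n, Integrable (z n) P := fun n => hwi.add ((hvi.sub hwi).const_mul _)
    have hbd : ∀ n, Integrable (fun ω => hypDeriv (z n ω) * (v ω - w ω)) P := fun n =>
      (hvi.sub hwi).bdd_mul (continuous_hypDeriv.measurable.comp (hzm n)).aestronglyMeasurable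
        (Eventually.of_forall fun ω => abs_hypDeriv_le _)
    have hpos : ∀ n, 0 ≤ ∫ ω, hypDeriv (z n ω) * (v ω - w ω) ∂P := by
      intro n
      have h1 := hmin _ (hXc ha ha' (sub_nonneg.2 (ht1 n)) (ht0 n).le (by ring)) _
        (hYc hb hb' (sub_nonneg.2 (ht1 n)) (ht0 n).le (by ring))
      rw [show (1 - t n) • a + t n • a' - ((1 - t n) • b + t n • b') = z n by
        funext ω
        simp only [hz, hw, hv, Pi.add_apply, Pi.sub_apply, Pi.smul_apply, smul_eq_mul]
        ring] at h1
      have h2 : ∫ ω, hyp (z n ω) ∂P - ∫ ω, hyp (w ω) ∂P ≤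
          ∫ ω, t n * (hypDeriv (z n ω) * (v ω - w ω)) ∂P := by
        rw [← integral_sub (integrable_hyp (hzi n)) (integrable_hyp hwi)]
        refine integral_mono ((integrable_hyp (hzi n)).sub (integrable_hyp hwi))
          ((hbd n).const_mul _) fun ω => (hyp_sub_le (w ω) (z n ω)).trans (le_of_eq ?_)
        simp only [hz]
        ring
      rw [integral_const_mul] at h2
      by_contra hneg
      push Not at hneg
      linarith [mul_neg_of_pos_of_neg (ht0 n) hneg]
    have htend : Tendsto (fun n => ∫ ω, hypDeriv (z n ω) * (v ω - w ω) ∂P) atTop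
        (𝓝 (∫ ω, η ω * (v ω - w ω) ∂P)) := by
      refine tendsto_integral_of_dominated_convergence (fun ω => |v ω - w ω|)
        (fun n => (hbd n).aestronglyMeasurable) (hvi.sub hwi).abs
        (fun n => Eventually.of_forall fun ω => ?_) (Eventually.of_forall fun ω => ?_)
      · rw [Real.norm_eq_abs, abs_mul]
        exact mul_le_of_le_one_left (abs_nonneg _) (abs_hypDeriv_le _)
      · refine Tendsto.mul_const _ ((continuous_hypDeriv.tendsto (w ω)).comp ?_)
        have := ((tendsto_one_div_add_atTop_nhds_zero_nat (𝕜 := ℝ)).mul_const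
          (v ω - w ω)).const_add (w ω)
        simpa [hz, ht] using this
    have hfin := ge_of_tendsto' htend hpos
    have heq : ∫ ω, η ω * (v ω - w ω) ∂P =
        pairing P a' η - pairing P b' η - ∫ ω, w ω * η ω ∂P := by
      have h1 : Integrable (fun ω => a' ω * η ω - b' ω * η ω) P :=
        (hmulη (hi (hX ha'))).sub (hmulη (hi (hY hb')))
      rw [pairing, pairing, ← integral_sub (hmulη (hi (hX ha'))) (hmulη (hi (hY hb'))),
        ← integral_sub h1 (hmulη hwi)]
      congr 1
      funext ω
      simp only [hv, Pi.sub_apply]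
      ring
    linarith

end Separation

section Polar

variable {Ω : Type*} [MeasurableSpace Ω] {P : Measure Ω} {Φ Ψ : ℝ → ℝ}

lemma bddAEClosed_modBall (hΨ : IsYoung Ψ) (r : ℝ) : BddAEClosed P Ψ (modBall P Ψ r) :=
  fun _ _ _ _ hξ _ hm hlim => modBall_of_tendsto_ae hΨ hξ hm hlim

lemma BddAEClosed.inter {X Y : Set (Ω → ℝ)} (hX : BddAEClosed P Ψ X) (hY : BddAEClosed P Ψ Y) :
    BddAEClosed P Ψ (X ∩ Y) := fun r hr ξ ξ₀ hξ hb hm hlim =>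
  ⟨hX r hr ξ ξ₀ (fun n => (hξ n).1) hb hm hlim, hY r hr ξ ξ₀ (fun n => (hξ n).2) hb hm hlim⟩

lemma pairing_div_right (f g : Ω → ℝ) (d : ℝ) :
    pairing P f (fun ω => g ω / d) = pairing P f g / d := by
  simp only [pairing, ← mul_div_assoc, integral_div]

/-- A boundedly a.e.-closed convex set which is disjoint from a modular ball can be separated from
that ball, within a larger ball, by a bounded function in the polar of the small ball. -/
lemma exists_separating_ball [IsProbabilityMeasure P] (hΨ : IsYoung Ψ) {r R : ℝ} (hr : 0 < r)
    (hrR : r ≤ R) {X : Set (Ω → ℝ)} (hXc : Convex ℝ X) (hXcl : BddAEClosed P Ψ X)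
    (hdisj : Disjoint X (modBall P Ψ r)) :
    ∃ η : Ω → ℝ, Measurable η ∧ (∃ M, ∀ ω, |η ω| ≤ M) ∧
      (∀ b ∈ modBall P Ψ r, pairing P b η ≤ 1) ∧
      ∀ a ∈ X, a ∈ modBall P Ψ R → 1 < pairing P a η := by
  rcases (X ∩ modBall P Ψ R).eq_empty_or_nonempty with hemp | hne
  · refine ⟨0, measurable_zero, ⟨0, by simp⟩, fun b _ => by simp [pairing], fun a ha haR => ?_⟩
    exact (eq_empty_iff_forall_notMem.1 hemp a ⟨ha, haR⟩).elim
  obtain ⟨η, hη, hη1, κ, hκ, hsep⟩ := exists_separating hΨ (hr.trans_le hrR)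
    (X := X ∩ modBall P Ψ R) (Y := modBall P Ψ r) inter_subset_right (modBall_mono hΨ hr hrR)
    (hXc.inter (convex_modBall hΨ R)) (convex_modBall hΨ r)
    (hXcl.inter (bddAEClosed_modBall hΨ R)) (bddAEClosed_modBall hΨ r) hne
    ⟨0, zero_mem_modBall hΨ r⟩ (hdisj.mono_left inter_subset_left)
  obtain ⟨a₀, ha₀⟩ := hne
  set V := (fun b => pairing P b η) '' modBall P Ψ r with hV
  have hVb : BddAbove V := ⟨pairing P a₀ η - κ, by
    rintro _ ⟨b, hb, rfl⟩
    linarith [hsep a₀ ha₀ b hb]⟩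
  have hVle : ∀ b ∈ modBall P Ψ r, pairing P b η ≤ sSup V := fun b hb =>
    le_csSup hVb ⟨b, hb, rfl⟩
  have h0 : 0 ≤ sSup V := by simpa [pairing] using hVle 0 (zero_mem_modBall hΨ r)
  have hle : ∀ a ∈ X ∩ modBall P Ψ R, sSup V + κ ≤ pairing P a η := fun a ha => by
    rw [← le_sub_iff_add_le]
    refine csSup_le ⟨_, 0, zero_mem_modBall hΨ r, rfl⟩ ?_
    rintro _ ⟨b, hb, rfl⟩
    linarith [hsep a ha b hb]
  have hd : 0 < sSup V + κ / 2 := by positivity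
  refine ⟨fun ω => η ω / (sSup V + κ / 2), hη.div_const _, ⟨1 / (sSup V + κ / 2), fun ω => ?_⟩,
    fun b hb => ?_, fun a ha haR => ?_⟩
  · rw [abs_div, abs_of_pos hd]
    exact div_le_div_of_nonneg_right (hη1 ω) hd.le
  · rw [pairing_div_right, div_le_one hd]
    linarith [hVle b hb]
  · rw [pairing_div_right, one_lt_div hd]
    linarith [hle a ⟨ha, haR⟩]

lemma exists_subgradient (hΦ : IsYoung Φ) :
    ∃ φ : ℝ → ℝ, Monotone φ ∧ ∀ x, Φ x + conj Φ (φ x) ≤ x * φ x := by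
  have hc : ∀ x : ℝ, x ∈ interior (univ : Set ℝ) := fun x => by simp
  refine ⟨fun x => derivWithin Φ (Ioi x) x, ?_, fun x => ?_⟩
  · have := hΦ.convexOn.monotoneOn_rightDeriv
    rw [interior_univ] at this
    exact monotoneOn_univ.1 this
  · rw [← le_sub_iff_add_le']
    refine ciSup_le fun y => ?_
    rcases lt_trichotomy y x with hyx | rfl | hxy
    · have h1 := (hΦ.convexOn.slope_le_leftDeriv_of_mem_interior (mem_univ y) (hc x) hyx).trans
        (hΦ.convexOn.leftDeriv_le_rightDeriv_of_mem_interior (hc x))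
      rw [slope_def_field, div_le_iff₀ (sub_pos.2 hyx)] at h1
      linarith
    · rfl
    · have h1 := hΦ.convexOn.rightDeriv_le_slope_of_mem_interior (hc x) (mem_univ y) hxy
      rw [slope_def_field, le_div_iff₀ (sub_pos.2 hxy)] at h1
      linarith

/-- Bounded functions in the polar of a modular ball of `L_{Φ*}` belong to a modular ball of
`L_Φ`. -/
lemma mem_modBall_of_polar [IsProbabilityMeasure P] (hΦ : IsYoung Φ) {r : ℝ} (hr : 0 < r)
    {η : Ω → ℝ} (hη : Measurable η) (hbdd : ∃ M, ∀ ω, |η ω| ≤ M)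
    (hpol : ∀ b ∈ modBall P (conj Φ) r, pairing P b η ≤ 1) : η ∈ modBall P Φ r⁻¹ := by
  obtain ⟨φ, hφ, hφΦ⟩ := exists_subgradient hΦ
  obtain ⟨M, hM⟩ := hbdd
  have hΨ := hΦ.conj_isYoung
  set g : Ω → ℝ := fun ω => η ω / r⁻¹ with hg
  have hgm : Measurable g := hη.div_const _
  have hgM : ∀ ω, |g ω| ≤ M / r⁻¹ := fun ω => by
    simp only [hg]
    rw [abs_div, abs_of_pos (inv_pos.2 hr)]
    exact div_le_div_of_nonneg_right (hM ω) (inv_pos.2 hr).le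
  set ξ : Ω → ℝ := fun ω => φ (g ω) with hξ
  have hξm : Measurable ξ := hφ.measurable.comp hgm
  set N := max |φ (-(M / r⁻¹))| |φ (M / r⁻¹)|
  have hξN : ∀ ω, |ξ ω| ≤ N := fun ω => by
    have h := abs_le.1 (hgM ω)
    exact abs_le_max_abs_abs (hφ h.1) (hφ h.2)
  have hbd : ∀ {F : ℝ → ℝ} {u : Ω → ℝ} {L : ℝ}, IsYoung F → Measurable u → (∀ ω, |u ω| ≤ L) →
      Integrable (fun ω => F (u ω)) P := fun {F u L} hF hu hL =>
    Integrable.of_bound (hF.continuous.measurable.comp hu).aestronglyMeasurable (F L)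
      (Eventually.of_forall fun ω => by
        rw [Real.norm_eq_abs, abs_of_nonneg (hF.nonneg _)]
        exact hF.mono_abs ((hL ω).trans (le_abs_self _)))
  have hA := hbd hΦ hgm hgM
  have hB := hbd hΨ hξm hξN
  have hgξ : Integrable (fun ω => g ω * ξ ω) P :=
    (Integrable.of_bound hgm.aestronglyMeasurable _ (Eventually.of_forall hgM)).mul_bdd
      hξm.aestronglyMeasurable (Eventually.of_forall hξN)
  have hyoung : ∫ ω, Φ (g ω) ∂P + ∫ ω, conj Φ (ξ ω) ∂P ≤ ∫ ω, g ω * ξ ω ∂P := by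
    rw [← integral_add hA hB]
    exact integral_mono (hA.add hB) hgξ fun ω => hφΦ _
  set m := max 1 (∫ ω, conj Φ (ξ ω) ∂P) with hm
  have hm1 : 1 ≤ m := le_max_left _ _
  have hm0 : 0 < m := one_pos.trans_le hm1
  have hmem : (fun ω => r * (ξ ω / m)) ∈ modBall P (conj Φ) r := by
    refine ⟨(hξm.div_const _).const_mul _, ?_⟩
    calc ∫⁻ ω, ENNReal.ofReal (conj Φ (r * (ξ ω / m) / r)) ∂P
        ≤ ∫⁻ ω, ENNReal.ofReal (m⁻¹ * conj Φ (ξ ω)) ∂P := by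
          refine lintegral_mono fun ω => ENNReal.ofReal_le_ofReal ?_
          rw [mul_div_cancel_left₀ _ hr.ne', div_eq_inv_mul]
          exact hΨ.map_mul_le (inv_nonneg.2 hm0.le) (inv_le_one_of_one_le₀ hm1) _
      _ = ENNReal.ofReal (m⁻¹ * ∫ ω, conj Φ (ξ ω) ∂P) := by
          rw [← integral_const_mul, ofReal_integral_eq_lintegral_ofReal (hB.const_mul _)
            (Eventually.of_forall fun ω => mul_nonneg (inv_nonneg.2 hm0.le) (hΨ.nonneg _))]
      _ ≤ 1 := by
          rw [ENNReal.ofReal_le_one, ← div_eq_inv_mul, div_le_one hm0]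
          exact le_max_right _ _
  have hle := hpol _ hmem
  have heq : pairing P (fun ω => r * (ξ ω / m)) η = (∫ ω, g ω * ξ ω ∂P) / m := by
    rw [pairing, ← integral_div]
    congr 1
    funext ω
    simp only [hg]
    field_simp
  rw [heq, div_le_one hm0] at hle
  refine ⟨hη, ?_⟩
  rw [← ofReal_integral_eq_lintegral_ofReal hA (Eventually.of_forall fun ω => hΦ.nonneg _),
    ENNReal.ofReal_le_one]
  have hB0 : 0 ≤ ∫ ω, conj Φ (ξ ω) ∂P := integral_nonneg fun ω => hΨ.nonneg _
  have hmle : m ≤ 1 + ∫ ω, conj Φ (ξ ω) ∂P := max_le (by linarith) (by linarith)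
  simp only [hg] at hyoung hle ⊢
  linarith

end Polar

section Separation

variable {Ω : Type*} [MeasurableSpace Ω] {P : Measure Ω} {Φ Ψ : ℝ → ℝ}

lemma modBall_of_abs_le (hΨ : IsYoung Ψ) {r : ℝ} {f g : Ω → ℝ} (hf : f ∈ modBall P Ψ r)
    (hg : Measurable g) (h : ∀ ω, |g ω| ≤ |f ω|) : g ∈ modBall P Ψ r := by
  refine ⟨hg, (lintegral_mono fun ω => ENNReal.ofReal_le_ofReal (hΨ.mono_abs ?_)).trans hf.2⟩
  rw [abs_div, abs_div]
  exact div_le_div_of_nonneg_right (h ω) (abs_nonneg r)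

lemma const_mul_mem_modBall {r c : ℝ} {f : Ω → ℝ} (hf : f ∈ modBall P Ψ (r / c)) :
    (fun ω => c * f ω) ∈ modBall P Ψ r := by
  refine ⟨hf.1.const_mul c, le_of_eq_of_le ?_ hf.2⟩
  congr 1 with ω
  congr 2
  rw [div_div_eq_mul_div, mul_comm]

lemma ae_summable_abs [IsProbabilityMeasure P] (hΨ : IsYoung Ψ) {r : ℝ} (hr : 0 < r)
    {f : ℕ → Ω → ℝ} (hf : ∀ n, f n ∈ modBall P Ψ (r / 2 ^ n)) :
    ∀ᵐ ω ∂P, Summable fun n => |f n ω| := by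
  obtain ⟨M, hM⟩ := exists_integral_abs_le (P := P) hΨ hr
  have hi : ∀ n, Integrable (fun ω => |f n ω|) P := fun n =>
    (integrable_of_mem_modBall hΨ (by positivity) (hf n)).abs
  have hle : ∀ n, ∫ ω, |f n ω| ∂P ≤ M * (1 / 2) ^ n := fun n => by
    have h := hM _ (const_mul_mem_modBall (hf n))
    simp only [abs_mul, integral_const_mul, abs_pow, abs_two] at h
    rw [one_div, inv_pow, ← div_eq_mul_inv, le_div_iff₀ (by positivity)]
    linarith
  have hs : Summable fun n => ∫ ω, |f n ω| ∂P :=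
    Summable.of_nonneg_of_le (fun n => integral_nonneg fun ω => abs_nonneg _) hle
      (summable_geometric_two.mul_left M)
  have hlt : ∫⁻ ω, ∑' n, ENNReal.ofReal |f n ω| ∂P ≠ ⊤ := by
    rw [lintegral_tsum fun n => (hi n).aestronglyMeasurable.aemeasurable.ennreal_ofReal]
    simp only [← ofReal_integral_eq_lintegral_ofReal (hi _)
      (Eventually.of_forall fun ω => abs_nonneg _)]
    exact hs.tsum_ofReal_ne_top
  have hmeas : AEMeasurable (fun ω => ∑' n, ENNReal.ofReal |f n ω|) P :=
    AEMeasurable.tsum fun n => (hi n).aestronglyMeasurable.aemeasurable.ennreal_ofReal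
  filter_upwards [ae_lt_top' hmeas hlt] with ω hω
  have := ENNReal.summable_toReal hω.ne
  simpa only [ENNReal.toReal_ofReal (abs_nonneg _)] using this

/-- A boundedly a.e.-closed set which does not contain `0` misses a modular ball. -/
lemma exists_disjoint_modBall [IsProbabilityMeasure P] (hΨ : IsYoung Ψ) {X : Set (Ω → ℝ)}
    (hX : BddAEClosed P Ψ X) (h0 : (0 : Ω → ℝ) ∉ X) :
    ∃ ρ > 0, Disjoint X (modBall P Ψ ρ) := by
  by_contra! hcon
  have hex : ∀ n : ℕ, ∃ ξ, ξ ∈ X ∧ ξ ∈ modBall P Ψ (1 / 2 ^ n) := fun n =>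
    not_disjoint_iff.1 (hcon _ (by positivity))
  choose ξ hξ hb using hex
  refine h0 (hX 1 one_pos ξ 0 hξ (fun n => modBall_mono hΨ (by positivity) ?_ (hb n))
    measurable_zero ?_)
  · rw [div_le_one (by positivity)]
    exact one_le_pow₀ one_le_two
  · filter_upwards [ae_summable_abs hΨ one_pos hb] with ω hω
    exact hω.of_abs.tendsto_atTop_zero

lemma BddAEClosed.inter_halfspace [IsProbabilityMeasure P] (hΨ : IsYoung Ψ) {X : Set (Ω → ℝ)}
    (hX : BddAEClosed P Ψ X) {η : Ω → ℝ} (hη : Measurable η) (hbdd : ∃ M, ∀ ω, |η ω| ≤ M)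
    (c : ℝ) : BddAEClosed P Ψ (X ∩ {ξ | pairing P ξ η ≤ c}) := by
  obtain ⟨M, hM⟩ := hbdd
  refine fun r hr ξ ξ₀ hξ hb hm hlim => ⟨hX r hr ξ ξ₀ (fun n => (hξ n).1) hb hm hlim, ?_⟩
  have hξ₀ := modBall_of_tendsto_ae hΨ hb hm hlim
  have hInt : ∀ {f : Ω → ℝ}, f ∈ modBall P Ψ r → Integrable (fun ω => f ω * η ω) P :=
    fun hf => (integrable_of_mem_modBall hΨ hr hf).mul_bdd hη.aestronglyMeasurable
      (Eventually.of_forall hM)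
  have hz := (tendsto_integral_abs_sub hΨ hr hb hξ₀ hlim).const_mul M
  rw [mul_zero] at hz
  have hT : Tendsto (fun n => pairing P (ξ n) η) atTop (𝓝 (pairing P ξ₀ η)) := by
    rw [tendsto_iff_norm_sub_tendsto_zero]
    refine squeeze_zero (fun _ => norm_nonneg _) (fun n => ?_) hz
    rw [pairing, pairing, ← integral_sub (hInt (hb n)) (hInt hξ₀), ← integral_const_mul]
    refine (norm_integral_le_integral_norm _).trans (integral_mono
      ((hInt (hb n)).sub (hInt hξ₀)).norm
      ((((integrable_of_mem_modBall hΨ hr (hb n)).sub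
        (integrable_of_mem_modBall hΨ hr hξ₀)).abs).const_mul M) fun ω => ?_)
    simp only [← sub_mul, norm_mul, Real.norm_eq_abs]
    rw [mul_comm]
    exact mul_le_mul_of_nonneg_right (hM ω) (abs_nonneg _)
  exact le_of_tendsto' hT fun n => (hξ n).2

lemma convex_inter_halfspace (hΦ : IsYoung Φ) {X : Set (Ω → ℝ)} (hX : X ⊆ Orlicz P (conj Φ))
    (hXc : Convex ℝ X) {η : Ω → ℝ} (hη : η ∈ Orlicz P Φ) (c : ℝ) :
    Convex ℝ (X ∩ {ξ | pairing P ξ η ≤ c}) := by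
  rintro f ⟨hf, hf1⟩ g ⟨hg, hg1⟩ a b ha hb hab
  refine ⟨hXc hf hg ha hb hab, ?_⟩
  have hif := (integrable_mul_of_mem_orlicz hΦ (hX hf) hη).const_mul a
  have hig := (integrable_mul_of_mem_orlicz hΦ (hX hg) hη).const_mul b
  have heq : pairing P (a • f + b • g) η = a * pairing P f η + b * pairing P g η := by
    simp only [pairing, ← integral_const_mul, ← integral_add hif hig]
    congr 1 with ω
    simp only [Pi.add_apply, Pi.smul_apply, smul_eq_mul]
    ring
  rw [mem_ofPred_eq, heq]
  calc _ ≤ a * c + b * c := by gcongr <;> assumption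
    _ = c := by rw [← add_mul, hab, one_mul]

lemma exists_separating_sequence [IsProbabilityMeasure P] (hΦ : IsYoung Φ) {X : Set (Ω → ℝ)}
    (hX : X ⊆ Orlicz P (conj Φ)) (hXc : Convex ℝ X) (hXcl : BddAEClosed P (conj Φ) X)
    (h0 : (0 : Ω → ℝ) ∉ X) :
    ∃ ρ > 0, ∃ η : ℕ → Ω → ℝ, (∀ n, η n ∈ modBall P Φ (ρ / 2 ^ n)) ∧
      ∀ ξ ∈ X, ∃ n, 1 < pairing P ξ (η n) := by
  have hΨ := hΦ.conj_isYoung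
  obtain ⟨ρ, hρ, hdisj⟩ := exists_disjoint_modBall hΨ hXcl h0
  set Good : ℕ → Set (Ω → ℝ) → Prop := fun n Y => Y ⊆ Orlicz P (conj Φ) ∧ Convex ℝ Y ∧
    BddAEClosed P (conj Φ) Y ∧ Disjoint Y (modBall P (conj Φ) (ρ * 2 ^ n)) with hGood
  have hstep : ∀ n Y, Good n Y → ∃ η, η ∈ modBall P Φ (ρ⁻¹ / 2 ^ n) ∧
      Good (n + 1) (Y ∩ {ξ | pairing P ξ η ≤ 1}) := by
    rintro n Y ⟨hY, hYc, hYcl, hYd⟩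
    have hr : 0 < ρ * 2 ^ n := by positivity
    obtain ⟨η, hη, hbdd, hpol, hsep⟩ := exists_separating_ball hΨ hr
      (R := ρ * 2 ^ (n + 1)) (by rw [pow_succ]; linarith) hYc hYcl hYd
    have hmem := mem_modBall_of_polar hΦ hr hη hbdd hpol
    refine ⟨η, by rwa [div_eq_mul_inv, ← mul_inv], inter_subset_left.trans hY,
      convex_inter_halfspace hΦ hY hYc (mem_orlicz_of_mem_modBall (inv_pos.2 hr) hmem) 1,
      hYcl.inter_halfspace hΨ hη hbdd 1, ?_⟩
    rw [disjoint_left]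
    exact fun ξ hξ hξb => (hsep ξ hξ.1 hξb).not_ge hξ.2
  choose! e he hG using hstep
  set Y : ℕ → Set (Ω → ℝ) := fun n =>
    Nat.rec X (fun k Z => Z ∩ {ξ | pairing P ξ (e k Z) ≤ 1}) n with hYdef
  have hYG : ∀ n, Good n (Y n) := fun n => by
    induction n with
    | zero => exact ⟨hX, hXc, hXcl, by rwa [pow_zero, mul_one]⟩
    | succ k ih => exact hG k _ ih
  refine ⟨ρ⁻¹, inv_pos.2 hρ, fun n => e n (Y n), fun n => he n _ (hYG n), fun ξ hξ => ?_⟩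
  by_contra! hcon
  have hmem : ∀ n, ξ ∈ Y n := fun n => by
    induction n with
    | zero => exact hξ
    | succ k ih => exact ⟨ih, hcon k⟩
  obtain ⟨R, hR, hξR⟩ := exists_mem_modBall hΨ (hX hξ)
  obtain ⟨n, hn⟩ := pow_unbounded_of_one_lt (R / ρ) one_lt_two
  rw [div_lt_iff₀' hρ] at hn
  exact disjoint_left.1 (hYG n).2.2.2 (hmem n) (modBall_mono hΨ hR hn.le hξR)

end Separation

section Hilbert

variable {Ω : Type*} [MeasurableSpace Ω] {P : Measure Ω} {Φ Ψ : ℝ → ℝ}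

lemma sum_half_pow_smul_mem {V : Type*} [AddCommGroup V] [Module ℝ V] {K : Set V}
    (hK : Convex ℝ K) (h0 : (0 : V) ∈ K) (N : ℕ) :
    ∀ f : ℕ → V, (∀ n, f n ∈ K) → ∑ n ∈ Finset.range N, ((1 / 2 : ℝ) ^ (n + 1)) • f n ∈ K := by
  induction N with
  | zero => exact fun f _ => by simpa using h0
  | succ N ih =>
    intro f hf
    have h := hK (ih (fun n => f (n + 1)) fun n => hf _) (hf 0)
      (show (0 : ℝ) ≤ 1 / 2 by norm_num) (show (0 : ℝ) ≤ 1 / 2 by norm_num) (by norm_num)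
    rw [Finset.sum_range_succ']
    simpa only [Finset.smul_sum, smul_smul, ← pow_succ', zero_add, pow_one] using h

lemma sum_abs_mem_modBall (hΨ : IsYoung Ψ) {r : ℝ} {f : ℕ → Ω → ℝ}
    (hf : ∀ n, f n ∈ modBall P Ψ (r / 2 ^ n)) (N : ℕ) :
    (fun ω => ∑ n ∈ Finset.range N, |f n ω|) ∈ modBall P Ψ (2 * r) := by
  have h := sum_half_pow_smul_mem (convex_modBall (P := P) hΨ (2 * r))
    (zero_mem_modBall hΨ _) N (fun n ω => 2 ^ (n + 1) * |f n ω|) fun n => by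
      refine const_mul_mem_modBall ?_
      rw [pow_succ', mul_div_mul_left _ _ two_ne_zero]
      exact modBall_of_abs_le hΨ (hf n) (hf n).1.abs fun ω => (abs_abs _).le
  convert h using 1
  funext ω
  rw [Finset.sum_apply]
  refine Finset.sum_congr rfl fun n _ => ?_
  rw [Pi.smul_apply, smul_eq_mul, ← mul_assoc, ← mul_pow]
  norm_num

lemma abs_pairing_le (hΦ : IsYoung Φ) {r s : ℝ} (hr : 0 < r) (hs : 0 < s) {f g : Ω → ℝ}
    (hf : f ∈ modBall P (conj Φ) r) (hg : g ∈ modBall P Φ s) : |pairing P f g| ≤ 2 * r * s := by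
  obtain ⟨hf1, hf2⟩ := integrable_modular hΦ.conj_isYoung hf
  obtain ⟨hg1, hg2⟩ := integrable_modular hΦ hg
  have hle : |∫ ω, f ω * g ω ∂P| ≤ ∫ ω, (r * s) * (conj Φ (f ω / r) + Φ (g ω / s)) ∂P := by
    rw [← Real.norm_eq_abs]
    refine norm_integral_le_of_norm_le ((hf1.add hg1).const_mul _)
      (Eventually.of_forall fun ω => ?_)
    have h := mul_le_mul_of_nonneg_left (hΦ.abs_mul_le (f ω / r) (g ω / s)) (mul_pos hr hs).le
    rwa [← abs_of_pos (mul_pos hr hs), ← abs_mul, abs_of_pos (mul_pos hr hs),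
      show r * s * (f ω / r * (g ω / s)) = f ω * g ω by field_simp] at h
  rw [integral_const_mul, integral_add hf1 hg1] at hle
  refine hle.trans ?_
  rw [show 2 * r * s = r * s * (1 + 1) by ring]
  exact mul_le_mul_of_nonneg_left (add_le_add hf2 hg2) (mul_pos hr hs).le

/-- A sequence of functions whose modular radii decay geometrically can be summed against any
bounded sequence of coefficients. -/
lemma exists_hasSum_pairing [IsProbabilityMeasure P] (hΦ : IsYoung Φ) {ρ : ℝ} (hρ : 0 < ρ)
    {η : ℕ → Ω → ℝ} (hη : ∀ n, η n ∈ modBall P Φ (ρ / 2 ^ n)) {v : ℕ → ℝ} {D : ℝ} (hD : 0 < D)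
    (hv : ∀ n, |v n| ≤ D) :
    ∃ ζ ∈ Orlicz P Φ, ∀ ξ ∈ Orlicz P (conj Φ),
      HasSum (fun n => pairing P ξ (η n) * v n) (pairing P ξ ζ) := by
  have hae := ae_summable_abs hΦ hρ hη
  obtain ⟨A, hA, hAm, hA0⟩ := exists_measurable_superset_of_null (ae_iff.1 hae)
  have hηA : ∀ n, Aᶜ.indicator (η n) ∈ modBall P Φ (ρ / 2 ^ n) := fun n =>
    modBall_of_abs_le hΦ (hη n) ((hη n).1.indicator hAm.compl) fun ω =>
      norm_indicator_le_norm_self (η n) ω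
  have hsum : ∀ ω, Summable fun n => |Aᶜ.indicator (η n) ω| := fun ω => by
    by_cases h : ω ∈ A
    · simp [h]
    · have : Summable fun n => |η n ω| := by
        by_contra hcon
        exact h (hA hcon)
      simpa [h] using this
  set S : Ω → ℝ := fun ω => ∑' n, |Aᶜ.indicator (η n) ω| with hS
  have hlim : ∀ ω, Tendsto (fun N => ∑ n ∈ Finset.range N, |Aᶜ.indicator (η n) ω|) atTop
      (𝓝 (S ω)) := fun ω => (hsum ω).hasSum.tendsto_sum_nat
  have hSm : Measurable S := measurable_of_tendsto_metrizable
    (fun N => Finset.measurable_fun_sum _ fun n _ => (hηA n).1.abs) (tendsto_pi_nhds.2 hlim)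
  have hSmem : S ∈ Orlicz P Φ := mem_orlicz_of_mem_modBall (r := 2 * ρ) (by positivity)
    (modBall_of_tendsto_ae hΦ (fun N => sum_abs_mem_modBall hΦ hηA N) hSm
      (Eventually.of_forall hlim))
  set u : ℕ → Ω → ℝ := fun n ω => Aᶜ.indicator (η n) ω * v n with hu
  have hum : ∀ n, Measurable (u n) := fun n => (hηA n).1.mul_const _
  have huS : ∀ (s : Finset ℕ) ω, ∑ n ∈ s, |u n ω| ≤ D * S ω := fun s ω => by
    calc ∑ n ∈ s, |u n ω| ≤ ∑ n ∈ s, D * |Aᶜ.indicator (η n) ω| :=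
          Finset.sum_le_sum fun n _ => by
            rw [hu, abs_mul, mul_comm]
            exact mul_le_mul_of_nonneg_right (hv n) (abs_nonneg _)
      _ ≤ D * S ω := by
          rw [← Finset.mul_sum]
          exact mul_le_mul_of_nonneg_left
            ((hsum ω).sum_le_tsum s fun _ _ => abs_nonneg _) hD.le
  have hDS := orlicz_const_mul hSmem hD
  refine ⟨_, tsum_mem_orlicz hΦ hum hDS huS, fun ξ hξ => ?_⟩
  have h := hasSum_pairing hum hξ.1 (integrable_mul_of_mem_orlicz hΦ hξ hDS) huS
  convert h using 2 with n
  rw [pairing, pairing, ← integral_mul_const]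
  refine integral_congr_ae ?_
  filter_upwards [compl_mem_ae_iff.2 hA0] with ω hω
  simp only [hu, indicator_of_mem hω, mul_assoc]

/-- A boundedly a.e.-closed convex set not containing `0` is separated from `0` by an element of
the predual. -/
lemma exists_one_le_pairing [IsProbabilityMeasure P] (hΦ : IsYoung Φ) {X : Set (Ω → ℝ)}
    (hX : X ⊆ Orlicz P (conj Φ)) (hXc : Convex ℝ X) (hXcl : BddAEClosed P (conj Φ) X)
    (h0 : (0 : Ω → ℝ) ∉ X) :
    ∃ ζ ∈ Orlicz P Φ, ∀ ξ ∈ X, 1 ≤ pairing P ξ ζ := by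
  rcases X.eq_empty_or_nonempty with rfl | ⟨ξ₀, hξ₀⟩
  · exact ⟨_, orlicz_const 0, by simp⟩
  obtain ⟨ρ, hρ, η, hη, hsep⟩ := exists_separating_sequence hΦ hX hXc hXcl h0
  have hηmem : ∀ n, η n ∈ Orlicz P Φ := fun n =>
    mem_orlicz_of_mem_modBall (by positivity) (hη n)
  have hlp : ∀ ξ ∈ Orlicz P (conj Φ), Memℓp (fun n => pairing P ξ (η n)) 2 := fun ξ hξ => by
    obtain ⟨R, hR, hξR⟩ := exists_mem_modBall hΦ.conj_isYoung hξ
    refine memℓp_gen ?_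
    refine Summable.of_nonneg_of_le (fun n => by positivity) (fun n => ?_)
      ((summable_geometric_of_lt_one (r := (1 / 4 : ℝ)) (by norm_num) (by norm_num)).mul_left
        ((2 * R * ρ) ^ 2))
    have h := abs_pairing_le hΦ hR (by positivity) hξR (hη n)
    rw [Real.norm_eq_abs, ENNReal.toReal_ofNat, Real.rpow_two]
    calc |pairing P ξ (η n)| ^ 2 ≤ (2 * R * (ρ / 2 ^ n)) ^ 2 := by gcongr
      _ = (2 * R * ρ) ^ 2 * (1 / 4) ^ n := by
          rw [show (1 / 4 : ℝ) = (2 ^ 2)⁻¹ by norm_num, inv_pow, ← pow_mul, mul_comm 2 n, pow_mul]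
          field_simp
  set S : Set (lp (fun _ : ℕ => ℝ) 2) := {y | ∃ ξ ∈ X, ∀ n, y n = pairing P ξ (η n)} with hS
  have hSmem : ∀ ξ ∈ X, ∃ y ∈ S, ∀ n, y n = pairing P ξ (η n) := fun ξ hξ =>
    ⟨⟨_, hlp ξ (hX hξ)⟩, ⟨ξ, hξ, fun _ => rfl⟩, fun _ => rfl⟩
  have hSc : Convex ℝ S := by
    rintro y ⟨f, hf, hyf⟩ z ⟨g, hg, hzg⟩ a b ha hb hab
    refine ⟨_, hXc hf hg ha hb hab, fun n => ?_⟩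
    have hif := (integrable_mul_of_mem_orlicz hΦ (hX hf) (hηmem n)).const_mul a
    have hig := (integrable_mul_of_mem_orlicz hΦ (hX hg) (hηmem n)).const_mul b
    rw [lp.coeFn_add, lp.coeFn_smul, lp.coeFn_smul, Pi.add_apply, Pi.smul_apply, Pi.smul_apply,
      smul_eq_mul, smul_eq_mul, hyf, hzg]
    simp only [pairing, ← integral_const_mul, ← integral_add hif hig]
    congr 1 with ω
    simp only [Pi.add_apply, Pi.smul_apply, smul_eq_mul]
    ring
  have hSn : ∀ y ∈ S, 1 ≤ ‖y‖ := by
    rintro y ⟨ξ, hξ, hy⟩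
    obtain ⟨n, hn⟩ := hsep ξ hξ
    have h := lp.norm_apply_le_norm two_ne_zero y n
    rw [hy n, Real.norm_eq_abs] at h
    exact hn.le.trans ((le_abs_self _).trans h)
  have hSne : S.Nonempty := (hSmem ξ₀ hξ₀).imp fun _ h => h.1
  obtain ⟨v, hvS, hv⟩ := exists_norm_eq_iInf_of_complete_convex
    hSne.closure isClosed_closure.isComplete hSc.closure 0
  rw [norm_eq_iInf_iff_real_inner_le_zero hSc.closure hvS] at hv
  have hv1 : 1 ≤ ‖v‖ := closure_minimal hSn (isClosed_le continuous_const continuous_norm) hvS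
  obtain ⟨ζ, hζ, hsum⟩ := exists_hasSum_pairing hΦ hρ hη (v := v) (one_pos.trans_le hv1)
    fun n => lp.norm_apply_le_norm two_ne_zero v n
  refine ⟨ζ, hζ, fun ξ hξ => ?_⟩
  obtain ⟨y, hyS, hy⟩ := hSmem ξ hξ
  have h1 := hv y (subset_closure hyS)
  have h2 : HasSum (fun n => pairing P ξ (η n) * v n) (inner ℝ v y) := by
    simp only [← hy]
    exact lp.hasSum_inner v y
  rw [zero_sub, inner_neg_left, inner_sub_right, h2.unique (hsum ξ (hX hξ)),
    real_inner_self_eq_norm_sq] at h1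
  nlinarith

end Hilbert

section Main

variable {Ω : Type*} [MeasurableSpace Ω] {P : Measure Ω} {Ψ : ℝ → ℝ}

lemma neg_mem_orlicz (hΨ : IsYoung Ψ) {f : Ω → ℝ} (hf : f ∈ Orlicz P Ψ) : -f ∈ Orlicz P Ψ := by
  obtain ⟨R, hR, hfR⟩ := exists_mem_modBall hΨ hf
  exact mem_orlicz_of_mem_modBall hR (neg_mem_modBall hΨ hfR)

lemma BddAEClosed.translate (hΨ : IsYoung Ψ) {C : Set (Ω → ℝ)} (hC : BddAEClosed P Ψ C)
    {ξ₀ : Ω → ℝ} (hξ₀ : ξ₀ ∈ Orlicz P Ψ) : BddAEClosed P Ψ {u | u + ξ₀ ∈ C} := by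
  obtain ⟨R, hR, hξ₀R⟩ := exists_mem_modBall hΨ hξ₀
  refine fun r hr u u₀ hu hb hm hlim => hC (2 * max r R) (by positivity) (fun n => u n + ξ₀) _ hu
    (fun n => add_mem_modBall hΨ (modBall_mono hΨ hr (le_max_left _ _) (hb n))
      (modBall_mono hΨ hR (le_max_right _ _) hξ₀R)) (hm.add hξ₀.1) ?_
  filter_upwards [hlim] with ω hω
  exact hω.add_const _

end Main

/-- If `Φ ∈ Δ₂`, every sequentially `τ(L_{Φ*},L_Φ)`-closed
convex subset of `L_{Φ*}` is `σ(L_{Φ*},L_Φ)`-closed. -/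
theorem statement15
    {Ω : Type*} [MeasurableSpace Ω] (P : Measure Ω) [IsProbabilityMeasure P]
    (Φ : ℝ → ℝ) (hΦ : IsYoung Φ) (hΔ : Delta2 Φ)
    (C : Set (Ω → ℝ)) (hC : C ⊆ Orlicz P (conj Φ)) (hconv : Convex ℝ C)
    (hseq : ∀ (ξ : ℕ → Orlicz P (conj Φ)) (ξ₀ : Orlicz P (conj Φ)),
      (∀ n, ↑(ξ n) ∈ C) →
      Tendsto ξ atTop (@nhds _ (mackeyT P (Orlicz P (conj Φ)) (Orlicz P Φ)) ξ₀) →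
      ↑ξ₀ ∈ C) :
    @IsClosed _ (weakT P (Orlicz P (conj Φ)) (Orlicz P Φ))
      {ξ : Orlicz P (conj Φ) | ↑ξ ∈ C} := by
  let _ : TopologicalSpace (Orlicz P (conj Φ)) := weakT P (Orlicz P (conj Φ)) (Orlicz P Φ)
  have hΨ := hΦ.conj_isYoung
  have hcl := bddAEClosed_of_sequentially_closed hΦ hΔ hC hconv hseq
  rw [← isOpen_compl_iff, isOpen_iff_mem_nhds]
  intro ξ₀ hξ₀
  obtain ⟨ζ, hζ, hsep⟩ := exists_one_le_pairing hΦ (X := {u : Ω → ℝ | u + (ξ₀ : Ω → ℝ) ∈ C})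
    (fun u hu => by
      have h := orlicz_add hΨ (hC hu) (neg_mem_orlicz hΨ ξ₀.2)
      rwa [add_neg_cancel_right] at h)
    (hconv.translate_preimage_left _) (hcl.translate hΨ ξ₀.2) (fun h => hξ₀ (by
      simpa using h))
  have hopen : IsOpen {ξ : Orlicz P (conj Φ) | pairing P ξ ζ < pairing P ξ₀ ζ + 1} :=
    isOpen_lt (continuous_pairing_right hζ) continuous_const
  refine mem_of_superset (hopen.mem_nhds (lt_add_one (pairing P ξ₀ ζ))) fun ξ hξ hξC => ?_
  have h := hsep ((ξ : Ω → ℝ) - (ξ₀ : Ω → ℝ)) (by simpa using hξC)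
  have heq : pairing P ((ξ : Ω → ℝ) - (ξ₀ : Ω → ℝ)) ζ = pairing P ξ ζ - pairing P ξ₀ ζ := by
    simp only [pairing, Pi.sub_apply, sub_mul]
    exact integral_sub (integrable_mul_of_mem_orlicz hΦ ξ.2 hζ)
      (integrable_mul_of_mem_orlicz hΦ ξ₀.2 hζ)
  have hlt : pairing P ξ ζ < pairing P ξ₀ ζ + 1 := hξ
  linarith

end OrliczPaper
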